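/- For every integer n ≥ 4 there exist a Ważewski dendrite X of order n and a subgroup S of Homeo(X) such that S is simple, finitely generated, and dense in Homeo(X). -/

import Mathlib

open Topology

/-- The set of connected components of a subset `S` of `X`. -/
def setComponents (X : Type*) [TopologicalSpace X] (S : Set X) : Set (Set X) :=
  {C | ∃ x ∈ S, C = connectedComponentIn S x}

/-- The order of a point `p` of `X`: the number of connected components of `X \ {p}`. -/
noncomputable def ptOrder (X : Type*) [TopologicalSpace X] (p : X) : ℕ :=
  (setComponents X {p}ᶜ).ncard

/-- A dendrite: a nonempty, compact, connected, locally connected metrizable space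
containing no subspace homeomorphic to the circle. -/
def IsDendrite (X : Type*) [TopologicalSpace X] : Prop :=
  Nonempty X ∧ CompactSpace X ∧ ConnectedSpace X ∧ LocallyConnectedSpace X ∧
    TopologicalSpace.MetrizableSpace X ∧
    ∀ S : Set X, IsEmpty (S ≃ₜ Circle)

/-- A Ważewski dendrite of order `n`: a dendrite all of whose points have order `1`, `2`
or `n`, and every arc (subspace homeomorphic to `[0,1]`) contains a point of order `n`. -/
def IsWazewskiDendrite (n : ℕ) (X : Type*) [TopologicalSpace X] : Prop :=
  IsDendrite X ∧
  (∀ p : X, ptOrder X p = 1 ∨ ptOrder X p = 2 ∨ ptOrder X p = n) ∧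
  ∀ A : Set X, Nonempty (A ≃ₜ unitInterval) → ∃ p ∈ A, ptOrder X p = n

/-- The group structure on self-homeomorphisms of `X`, with composition as product. -/
instance Homeomorph.instGroupSelf (X : Type*) [TopologicalSpace X] : Group (X ≃ₜ X) where
  mul f g := g.trans f
  one := Homeomorph.refl X
  inv := Homeomorph.symm
  mul_assoc _ _ _ := rfl
  one_mul _ := Homeomorph.ext fun _ => rfl
  mul_one _ := Homeomorph.ext fun _ => rfl
  inv_mul_cancel := Homeomorph.self_trans_symm

/-- The compact-open topology on the group of self-homeomorphisms of `X` (for compact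
metric `X`, this is the topology of uniform convergence). -/
instance Homeomorph.instTopSelf (X : Type*) [TopologicalSpace X] :
    TopologicalSpace (X ≃ₜ X) :=
  TopologicalSpace.induced (fun h : X ≃ₜ X => (h : C(X, X))) ContinuousMap.compactOpen


open Topology

namespace Waz
open scoped Pointwise commutatorElement
set_option linter.unusedSectionVars false
set_option linter.style.haveILetI false

section AbstractGroup

variable {E X : Type*} [Group E] [MulAction E X]

/-- `e` fixes `V` pointwise. -/
def FixOn (e : E) (V : Set X) : Prop := ∀ x ∈ V, e • x = x

/-- `e` is supported in `V`. -/
def SuppIn (e : E) (V : Set X) : Prop := ∀ x, x ∉ V → e • x = x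

/-- The subgroup `P` compresses the complement of any half-tree into any half-tree. -/
def Compresses (T : Set (Set X)) (P : Subgroup E) : Prop :=
  ∀ H ∈ T, ∀ H' ∈ T, ∃ e ∈ P, ∀ x, x ∉ H → e • x ∈ H'

theorem FixOn.mono {e : E} {V W : Set X} (h : FixOn e V) (hW : W ⊆ V) : FixOn e W :=
  fun x hx => h x (hW hx)

theorem SuppIn.mono {e : E} {V W : Set X} (h : SuppIn e V) (hW : V ⊆ W) : SuppIn e W :=
  fun x hx => h x (fun h' => hx (hW h'))

theorem SuppIn.inv {e : E} {V : Set X} (h : SuppIn e V) : SuppIn e⁻¹ V :=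
  fun x hx => by rw [inv_smul_eq_iff, h x hx]

theorem FixOn.inv {e : E} {V : Set X} (h : FixOn e V) : FixOn e⁻¹ V :=
  fun x hx => by rw [inv_smul_eq_iff, h x hx]

theorem FixOn.mul {e e' : E} {V : Set X} (h : FixOn e V) (h' : FixOn e' V) :
    FixOn (e * e') V :=
  fun x hx => by rw [mul_smul, h' x hx, h x hx]

theorem SuppIn.fixOn {e : E} {V W : Set X} (h : SuppIn e V) (hd : Disjoint V W) : FixOn e W :=
  fun x hx => h x (fun h' => Set.disjoint_left.1 hd h' hx)

theorem SuppIn.commute [FaithfulSMul E X] {a b : E} {V : Set X} (ha : SuppIn a V)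
    (hb : FixOn b V) : a * b = b * a := by
  apply FaithfulSMul.eq_of_smul_eq_smul (α := X)
  intro x
  rw [mul_smul, mul_smul]
  by_cases hx : x ∈ V
  · rw [hb x hx]
    by_cases hax : a • x ∈ V
    · rw [hb _ hax]
    · have h1 := ha _ hax
      have h2 : a • x = x := smul_left_cancel a h1
      rw [h2, hb x hx]
  · rw [ha x hx]
    by_cases hbx : b • x ∈ V
    · have h1 := hb _ hbx
      have h2 : b • x = x := smul_left_cancel b h1
      rw [h2] at hbx
      exact absurd hbx hx
    · exact ha _ hbx

theorem SuppIn.conj {a u : E} {V W : Set X} (ha : SuppIn a V)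
    (h : ∀ x ∈ V, u • x ∈ W) : SuppIn (u * a * u⁻¹) W := by
  intro x hx
  rw [mul_smul, mul_smul, ha, smul_inv_smul]
  intro h'
  have := h _ h'
  rw [smul_inv_smul] at this
  exact hx this

theorem FixOn.conj {a : E} (u : E) {V : Set X} (ha : FixOn a V) : FixOn (u * a * u⁻¹) (u • V) := by
  intro x hx
  rw [Set.mem_smul_set_iff_inv_smul_mem] at hx
  rw [mul_smul, mul_smul, ha _ hx, smul_inv_smul]

theorem FixOn.conj_supp {a u : E} {H W : Set X} (ha : FixOn a H)
    (h : ∀ x, x ∉ H → u • x ∈ W) : SuppIn (u * a * u⁻¹) W :=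
  SuppIn.conj (V := Hᶜ) (fun x hx => ha x (not_not.1 hx)) h

/-- The hypotheses of the abstract simplicity / finite generation lemma. -/
structure TreeHyp (T : Set (Set X)) (B : Set E) (H1 H2 : Set X) : Prop where
  inv : ∀ (e : E), ∀ H ∈ T, e • H ∈ T
  ne : ∀ H ∈ T, H.Nonempty
  comp : Compresses T (⊤ : Subgroup E)
  split : ∀ H ∈ T, ∃ H' ∈ T, ∃ H'' ∈ T, H' ⊆ H ∧ H'' ⊆ H ∧ Disjoint H' H''
  move : ∀ e : E, e ≠ 1 → ∃ H ∈ T, ∀ x ∈ H, e • x ∉ H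
  fin : B.Finite
  binv : ∀ b ∈ B, b⁻¹ ∈ B
  gen : Subgroup.closure B = ⊤
  mem1 : H1 ∈ T
  mem2 : H2 ∈ T
  disj : Disjoint H1 H2
  fix : ∀ b ∈ B, FixOn b H1 ∨ FixOn b H2
  pair : ∀ b ∈ B, ∀ b' ∈ B, b * b' = b' * b ∨ ∃ H ∈ T, FixOn b H ∧ FixOn b' H

variable [FaithfulSMul E X] {T : Set (Set X)} {B : Set E} {H1 H2 : Set X}

theorem comm_of_comm {a b c d : E} (h1 : c * b = b * c) (h2 : d * a = a * d) (h3 : c * d = d * c) :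
    ⁅a * c, b * d⁆ = ⁅a, b⁆ := by
  have e1 : c * (b * d) * c⁻¹ = b * d := by
    rw [mul_inv_eq_iff_eq_mul, ← mul_assoc, h1, mul_assoc, h3, mul_assoc]
  have e2 : d * a⁻¹ * d⁻¹ = a⁻¹ := by
    have : d * a⁻¹ = a⁻¹ * d := by
      rw [eq_inv_mul_iff_mul_eq, ← mul_assoc, ← h2, mul_assoc, mul_inv_cancel, mul_one]
    rw [this]; group
  calc ⁅a * c, b * d⁆ = a * (c * (b * d) * c⁻¹) * a⁻¹ * (b * d)⁻¹ := by
        rw [commutatorElement_def]; group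
    _ = a * b * (d * a⁻¹ * d⁻¹) * b⁻¹ := by rw [e1]; group
    _ = ⁅a, b⁆ := by rw [e2, commutatorElement_def]

/-- L1. -/
theorem TreeHyp.double (h : TreeHyp T B H1 H2) {N P : Subgroup E}
    (hP : Compresses T P) (hN : ∀ p ∈ P, ∀ v ∈ N, p * v * p⁻¹ ∈ N)
    {v : E} (hv : v ∈ N) (hv1 : v ≠ 1) {a b : E} (ha : a ∈ P) (hb : b ∈ P)
    {H0 : Set X} (h0 : H0 ∈ T) (ha0 : FixOn a H0) (hb0 : FixOn b H0) : ⁅a, b⁆ ∈ N := by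
  obtain ⟨H, hH, hmv⟩ := h.move v hv1
  obtain ⟨u, hu, hc⟩ := hP H0 h0 H hH
  have sa := ha0.conj_supp hc
  have sb := hb0.conj_supp hc
  set a' := u * a * u⁻¹ with ha'
  set b' := u * b * u⁻¹ with hb'
  have ma : a' ∈ P := P.mul_mem (P.mul_mem hu ha) (P.inv_mem hu)
  have mb : b' ∈ P := P.mul_mem (P.mul_mem hu hb) (P.inv_mem hu)
  set c := v * a'⁻¹ * v⁻¹ with hc'
  have sc : SuppIn c (Hᶜ) := sa.inv.conj (fun x hx => hmv x hx)
  have e1 : c * b' = b' * c := by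
    refine (sb.commute (sc.fixOn ?_)).symm
    exact disjoint_compl_left
  have k1 : a' * c ∈ N := by
    have : a' * c = (a' * v * a'⁻¹) * v⁻¹ := by rw [hc']; group
    rw [this]
    exact N.mul_mem (hN _ ma _ hv) (N.inv_mem hv)
  have k2 : ⁅a' * c, b'⁆ ∈ N := by
    have : ⁅a' * c, b'⁆ = (a' * c) * (b' * (a' * c)⁻¹ * b'⁻¹) := by
      rw [commutatorElement_def]; group
    rw [this]
    exact N.mul_mem k1 (hN _ mb _ (N.inv_mem k1))
  have k3 : ⁅a' * c, b' * 1⁆ = ⁅a', b'⁆ := comm_of_comm e1 (by simp) (by simp)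
  rw [mul_one] at k3
  rw [k3] at k2
  have : ⁅a, b⁆ = u⁻¹ * ⁅a', b'⁆ * (u⁻¹)⁻¹ := by
    rw [commutatorElement_def, commutatorElement_def, ha', hb']; group
  rw [this]
  exact hN _ (P.inv_mem hu) _ k2

theorem mem_commutator (a b : E) : ⁅a, b⁆ ∈ commutator E := by
  rw [commutator_def]
  exact Subgroup.commutator_mem_commutator (Subgroup.mem_top _) (Subgroup.mem_top _)

theorem TreeHyp.hb (h : TreeHyp T B H1 H2) {b : E} (hb : b ∈ B) : ∃ H ∈ T, FixOn b H := by
  rcases h.fix b hb with h1 | h1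
  · exact ⟨_, h.mem1, h1⟩
  · exact ⟨_, h.mem2, h1⟩

/-- Local agreement with commutators. -/
theorem TreeHyp.agree (h : TreeHyp T B H1 H2) (e : E) :
    ∀ H ∈ T, ∃ s ∈ commutator E, ∀ x, x ∉ H → s • x = e • x := by
  have he : e ∈ Subgroup.closure B := by rw [h.gen]; trivial
  induction he using Subgroup.closure_induction with
  | mem b hb =>
    intro H hH
    obtain ⟨Hb, hHb, hfix⟩ := h.hb hb
    obtain ⟨y, -, hy⟩ := h.comp Hb hHb H hH
    refine ⟨⁅b, y⁆, mem_commutator _ _, fun x hx => ?_⟩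
    have : ⁅b, y⁆ = b * (y * b⁻¹ * y⁻¹) := by rw [commutatorElement_def]; group
    rw [this, mul_smul, hfix.inv.conj_supp hy x hx]
  | one => exact fun H _ => ⟨1, Subgroup.one_mem _, fun _ _ => rfl⟩
  | mul e e' _ _ ih ih' =>
    intro H hH
    obtain ⟨s', hs', h1⟩ := ih' H hH
    obtain ⟨s, hs, h2⟩ := ih (e' • H) (h.inv _ _ hH)
    refine ⟨s * s', Subgroup.mul_mem _ hs hs', fun x hx => ?_⟩
    rw [mul_smul, mul_smul, h1 x hx, h2]
    rwa [Set.smul_mem_smul_set_iff]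
  | inv e _ ih =>
    intro H hH
    obtain ⟨s, hs, h1⟩ := ih (e⁻¹ • H) (h.inv _ _ hH)
    refine ⟨s⁻¹, Subgroup.inv_mem _ hs, fun x hx => ?_⟩
    rw [inv_smul_eq_iff, h1, smul_inv_smul]
    rwa [Set.smul_mem_smul_set_iff]

theorem TreeHyp.compS (h : TreeHyp T B H1 H2) : Compresses T (commutator E) := by
  intro H hH H' hH'
  obtain ⟨e, -, he⟩ := h.comp H hH H' hH'
  obtain ⟨s, hs, h1⟩ := h.agree e H hH
  exact ⟨s, hs, fun x hx => by rw [h1 x hx]; exact he x hx⟩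

theorem commutator_le_of_gen {N : Subgroup E} [N.Normal] (hB : Subgroup.closure B = ⊤)
    (hc : ∀ b ∈ B, ∀ b' ∈ B, ⁅b, b'⁆ ∈ N) : commutator E ≤ N := by
  have key : ∀ x y : E, Commute (x : E ⧸ N) (y : E ⧸ N) := by
    intro x y
    have hx : x ∈ Subgroup.closure B := by rw [hB]; trivial
    have hy : y ∈ Subgroup.closure B := by rw [hB]; trivial
    induction hx using Subgroup.closure_induction with
    | one => exact Commute.one_left _
    | mul a b _ _ iha ihb => exact Commute.mul_left iha ihb
    | inv a _ ih => exact Commute.inv_left ih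
    | mem b hb =>
      induction hy using Subgroup.closure_induction with
      | one => exact Commute.one_right _
      | mul a b _ _ iha ihb => exact Commute.mul_right iha ihb
      | inv a _ ih => exact Commute.inv_right ih
      | mem b' hb' =>
        have := (QuotientGroup.eq_one_iff (N := N) ⁅b, b'⁆).2 (hc b hb b' hb')
        rw [← commutatorElement_eq_one_iff_commute]
        exact this
  rw [commutator_def, Subgroup.commutator_le]
  intro x _ y _
  rw [← QuotientGroup.eq_one_iff]
  exact commutatorElement_eq_one_iff_commute.2 (key x y)

/-- The subgroup generated by commutators of elements of the derived subgroup jointly fixing a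
half-tree. -/
def derM (T : Set (Set X)) : Subgroup E :=
  Subgroup.closure {g | ∃ a ∈ commutator E, ∃ b ∈ commutator E, ∃ H ∈ T,
    FixOn a H ∧ FixOn b H ∧ g = ⁅a, b⁆}

theorem TreeHyp.derM_normal (h : TreeHyp T B H1 H2) : (derM T : Subgroup E).Normal := by
  constructor
  intro g hg u
  induction hg using Subgroup.closure_induction with
  | one => simp
  | mul x y _ _ hx hy =>
    have : u * (x * y) * u⁻¹ = (u * x * u⁻¹) * (u * y * u⁻¹) := by group
    rw [this]; exact Subgroup.mul_mem _ hx hy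
  | inv x _ hx =>
    have : u * x⁻¹ * u⁻¹ = (u * x * u⁻¹)⁻¹ := by group
    rw [this]; exact Subgroup.inv_mem _ hx
  | mem g hg =>
    obtain ⟨a, ha, b, hb, H, hH, h1, h2, rfl⟩ := hg
    apply Subgroup.subset_closure
    have hn : (commutator E).Normal := inferInstance
    refine ⟨u * a * u⁻¹, hn.conj_mem _ ha _, u * b * u⁻¹, hn.conj_mem _ hb _, u • H,
      h.inv _ _ hH, h1.conj u, h2.conj u, ?_⟩
    rw [commutatorElement_def, commutatorElement_def]; group

theorem TreeHyp.le_derM (h : TreeHyp T B H1 H2) : commutator E ≤ derM T := by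
  haveI := h.derM_normal
  refine commutator_le_of_gen h.gen ?_
  intro b hb b' hb'
  rcases h.pair b hb b' hb' with hc | ⟨H, hH, f1, f2⟩
  · rw [commutatorElement_eq_one_iff_mul_comm.2 hc]; exact Subgroup.one_mem _
  · obtain ⟨K1, hK1, K2, hK2, s1, s2, d12⟩ := h.split H hH
    obtain ⟨L1, hL1, L2, hL2, t1, t2, d34⟩ := h.split K2 hK2
    obtain ⟨y, -, hy⟩ := h.comp H hH K1 hK1
    obtain ⟨y', -, hy'⟩ := h.comp H hH L1 hL1
    have c1 := f1.inv.conj_supp hy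
    have c2 := f2.inv.conj_supp hy'
    have e1 : ⁅b, y⁆ = b * (y * b⁻¹ * y⁻¹) := by rw [commutatorElement_def]; group
    have e2 : ⁅b', y'⁆ = b' * (y' * b'⁻¹ * y'⁻¹) := by rw [commutatorElement_def]; group
    apply Subgroup.subset_closure
    refine ⟨⁅b, y⁆, mem_commutator _ _, ⁅b', y'⁆, mem_commutator _ _, L2, hL2, ?_, ?_, ?_⟩
    · rw [e1]
      exact (f1.mono (t2.trans s2)).mul (c1.fixOn (d12.mono_right t2))
    · rw [e2]
      exact (f2.mono (t2.trans s2)).mul (c2.fixOn d34)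
    · rw [e1, e2]
      refine (comm_of_comm ?_ ?_ ?_).symm
      · exact c1.commute (f2.mono s1)
      · exact c2.commute (f1.mono (t1.trans s2))
      · exact c1.commute (c2.fixOn (d12.symm.mono_left t1))

theorem TreeHyp.exists_ne (h : TreeHyp T B H1 H2) : ∃ s ∈ commutator E, s ≠ 1 := by
  obtain ⟨s, hs, h1⟩ := h.compS H1 h.mem1 H1 h.mem1
  refine ⟨s, hs, fun he => ?_⟩
  obtain ⟨x, hx⟩ := h.ne H2 h.mem2
  have hx1 : x ∉ H1 := fun h' => Set.disjoint_left.1 h.disj h' hx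
  have := h1 x hx1
  rw [he, one_smul] at this
  exact hx1 this

theorem TreeHyp.simple (h : TreeHyp T B H1 H2) : IsSimpleGroup (commutator E) := by
  obtain ⟨s, hs, hs1⟩ := h.exists_ne
  haveI : Nontrivial (commutator E) :=
    ⟨⟨⟨s, hs⟩, 1, fun he => hs1 (congrArg Subtype.val he)⟩⟩
  refine ⟨fun N hN => ?_⟩
  rw [or_iff_not_imp_left]
  intro hbot
  obtain ⟨v, hv, hv1⟩ := (Subgroup.ne_bot_iff_exists_ne_one (H := N)).1 hbot |>.imp fun v hv => (⟨v.2, hv⟩ : _ ∧ _)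
  have key : derM T ≤ N.map (commutator E).subtype := by
    unfold derM
    rw [Subgroup.closure_le]
    rintro _ ⟨a, ha, b, hb, H, hH, h1, h2, rfl⟩
    refine h.double (P := commutator E) h.compS ?_ (v := ((v : commutator E) : E)) ?_ ?_ ha hb hH h1 h2
    · rintro p hp _ ⟨w, hw, rfl⟩
      exact ⟨⟨p, hp⟩ * w * ⟨p, hp⟩⁻¹, hN.conj_mem _ hw _, rfl⟩
    · exact ⟨v, hv, rfl⟩
    · intro he
      apply hv1
      ext
      simpa using he
  rw [eq_top_iff]
  rintro x -
  obtain ⟨y, hy, hyx⟩ := key (h.le_derM x.2)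
  have : y = x := Subtype.ext hyx
  rwa [← this]

theorem TreeHyp.fg (h : TreeHyp T B H1 H2) : (commutator E).FG := by
  classical
  obtain ⟨z1, hz1, z1', hz1', i1, i1', d1⟩ := h.split H1 h.mem1
  obtain ⟨z2, hz2, z2', hz2', i2, i2', d2⟩ := h.split H2 h.mem2
  set Z : Set (Set X) := {z1, z1', z2, z2'} with hZ
  have hZT : ∀ z ∈ Z, z ∈ T := by
    rintro z (rfl | rfl | rfl | rfl) <;> assumption
  have hy : ∀ b : E, ∀ z : Set X, ∃ y : E, b ∈ B → z ∈ Z → SuppIn (y * b⁻¹ * y⁻¹) z := by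
    intro b z
    by_cases hb : b ∈ B
    · by_cases hz : z ∈ Z
      · obtain ⟨H, hH, hf⟩ := h.hb hb
        obtain ⟨y, -, hy⟩ := h.comp H hH z (hZT z hz)
        exact ⟨y, fun _ _ => hf.inv.conj_supp hy⟩
      · exact ⟨1, fun _ h' => absurd h' hz⟩
    · exact ⟨1, fun h' => absurd h' hb⟩
  choose y hy using hy
  set S0 : Subgroup E := Subgroup.closure ((fun q : E × Set X => ⁅q.1, y q.1 q.2⁆) '' (B ×ˢ Z)) with hS0
  have hex : ∀ b ∈ B, ∀ z ∈ Z, ∃ z' ∈ Z, FixOn b z' ∧ Disjoint z z' := by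
    have dd : ∀ u v : Set X, u ⊆ H1 → v ⊆ H2 → Disjoint u v :=
      fun u v hu hv => h.disj.mono hu hv
    intro b hb z hz
    rcases h.fix b hb with hf | hf
    · rcases hz with rfl | rfl | rfl | rfl
      · exact ⟨z1', by simp [hZ], hf.mono i1', d1⟩
      · exact ⟨z1, by simp [hZ], hf.mono i1, d1.symm⟩
      · exact ⟨z1, by simp [hZ], hf.mono i1, (dd _ _ i1 i2).symm⟩
      · exact ⟨z1, by simp [hZ], hf.mono i1, (dd _ _ i1 i2').symm⟩
    · rcases hz with rfl | rfl | rfl | rfl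
      · exact ⟨z2, by simp [hZ], hf.mono i2, dd _ _ i1 i2⟩
      · exact ⟨z2, by simp [hZ], hf.mono i2, dd _ _ i1' i2⟩
      · exact ⟨z2', by simp [hZ], hf.mono i2', d2⟩
      · exact ⟨z2, by simp [hZ], hf.mono i2, d2.symm⟩
  have ecomm : ∀ b y : E, ⁅b, y⁆ = b * (y * b⁻¹ * y⁻¹) := by
    intro b y; rw [commutatorElement_def]; group
  have hmem : ∀ b ∈ B, ∀ z ∈ Z, ⁅b, y b z⁆ ∈ S0 := fun b hb z hz =>
    Subgroup.subset_closure ⟨(b, z), ⟨hb, hz⟩, rfl⟩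
  have hconjB : ∀ b0 ∈ B, ∀ g ∈ S0, b0 * g * b0⁻¹ ∈ S0 := by
    intro b0 hb0 g hg
    induction hg using Subgroup.closure_induction with
    | one => simp
    | mul x y _ _ hx hy =>
      have : b0 * (x * y) * b0⁻¹ = (b0 * x * b0⁻¹) * (b0 * y * b0⁻¹) := by group
      rw [this]; exact Subgroup.mul_mem _ hx hy
    | inv x _ hx =>
      have : b0 * x⁻¹ * b0⁻¹ = (b0 * x * b0⁻¹)⁻¹ := by group
      rw [this]; exact Subgroup.inv_mem _ hx
    | mem g hg =>
      obtain ⟨⟨b, z⟩, ⟨hb, hz⟩, rfl⟩ := hg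
      obtain ⟨z', hz', hf, hd⟩ := hex b hb z hz
      have c0 := hy b0 z' hb0 hz'
      have c1 := hy b z hb hz
      have e0 : (y b0 z' * b0⁻¹ * (y b0 z')⁻¹) * ⁅b, y b z⁆ =
          ⁅b, y b z⁆ * (y b0 z' * b0⁻¹ * (y b0 z')⁻¹) := by
        rw [ecomm b]
        exact c0.commute (hf.mul (c1.fixOn hd))
      have : b0 * ⁅b, y b z⁆ * b0⁻¹ = ⁅b0, y b0 z'⁆ * ⁅b, y b z⁆ * ⁅b0, y b0 z'⁆⁻¹ := by
        rw [ecomm b0, mul_assoc b0 (y b0 z' * b0⁻¹ * (y b0 z')⁻¹), e0]; group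
      simp only
      rw [this]
      exact S0.mul_mem (S0.mul_mem (hmem _ hb0 _ hz') (hmem _ hb _ hz)) (S0.inv_mem (hmem _ hb0 _ hz'))
  have hnorm : S0.Normal := by
    have hh : ∀ u : E, (∀ g ∈ S0, u * g * u⁻¹ ∈ S0) ∧ (∀ g ∈ S0, u⁻¹ * g * (u⁻¹)⁻¹ ∈ S0) := by
      intro u
      have hu : u ∈ Subgroup.closure B := by rw [h.gen]; trivial
      induction hu using Subgroup.closure_induction with
      | one => simp
      | mem b hb => exact ⟨hconjB b hb, hconjB _ (h.binv b hb)⟩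
      | inv x _ hx => exact ⟨hx.2, by simpa using hx.1⟩
      | mul x y _ _ hx hy =>
        constructor
        · intro g hg
          have : x * y * g * (x * y)⁻¹ = x * (y * g * y⁻¹) * x⁻¹ := by group
          rw [this]; exact hx.1 _ (hy.1 _ hg)
        · intro g hg
          have : (x * y)⁻¹ * g * ((x * y)⁻¹)⁻¹ = y⁻¹ * (x⁻¹ * g * (x⁻¹)⁻¹) * (y⁻¹)⁻¹ := by group
          rw [this]; exact hy.2 _ (hx.2 _ hg)
    exact ⟨fun g hg u => (hh u).1 g hg⟩
  have hS0ne : ∃ v ∈ S0, v ≠ 1 := by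
    by_contra! hcon
    have hb1 : ∀ b ∈ B, b = 1 := by
      intro b hb
      apply FaithfulSMul.eq_of_smul_eq_smul (α := X)
      intro x
      have aux : ∀ z ∈ Z, x ∉ z → b • x = x := by
        intro z hz hx
        have h1 := hcon _ (hmem b hb z hz)
        rw [ecomm] at h1
        have h2 := hy b z hb hz x hx
        calc b • x = b • ((y b z * b⁻¹ * (y b z)⁻¹) • x) := by rw [h2]
          _ = x := by rw [← mul_smul, h1, one_smul]
      rw [one_smul]
      by_cases hx : x ∈ z1
      · exact aux z1' (by simp [hZ]) (fun h' => Set.disjoint_left.1 d1 hx h')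
      · exact aux z1 (by simp [hZ]) hx
    obtain ⟨s, -, hs⟩ := h.exists_ne
    apply hs
    have : s ∈ Subgroup.closure B := by rw [h.gen]; trivial
    have h2 : Subgroup.closure B ≤ ⊥ := by
      rw [Subgroup.closure_le]
      intro b hb; exact hb1 b hb
    exact h2 this
  obtain ⟨v, hv, hv1⟩ := hS0ne
  have hle : commutator E ≤ S0 := by
    refine commutator_le_of_gen h.gen ?_
    intro b hb b' hb'
    rcases h.pair b hb b' hb' with hc | ⟨H, hH, f1, f2⟩
    · rw [commutatorElement_eq_one_iff_mul_comm.2 hc]; exact Subgroup.one_mem _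
    · exact h.double (P := ⊤) h.comp (fun p _ w hw => hnorm.conj_mem w hw p) hv hv1
        trivial trivial hH f1 f2
  have hge : S0 ≤ commutator E := by
    rw [hS0, Subgroup.closure_le]
    rintro _ ⟨⟨b, z⟩, -, rfl⟩
    exact mem_commutator _ _
  rw [le_antisymm hle hge, Subgroup.fg_iff]
  refine ⟨_, rfl, Set.Finite.image _ (h.fin.prod ?_)⟩
  rw [hZ]
  exact Set.toFinite _

end AbstractGroup
end Waz

open Topology

namespace Waz
set_option linter.unusedSimpArgs false

/-- The alphabet. -/
abbrev L (N : ℕ) := Fin (N + 4)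
/-- Codes. -/
abbrev K (N : ℕ) := ℕ → L N

variable {N : ℕ}

theorem l01 : (0 : L N) ≠ 1 := by simp
theorem l10 : (1 : L N) ≠ 0 := by simp
theorem l02 : (0 : L N) ≠ 2 := by simp [Fin.ext_iff, Nat.mod_eq_of_lt]
theorem l20 : (2 : L N) ≠ 0 := by simp [Fin.ext_iff, Nat.mod_eq_of_lt]
theorem l12 : (1 : L N) ≠ 2 := by simp [Fin.ext_iff, Nat.mod_eq_of_lt]
theorem l21 : (2 : L N) ≠ 1 := by simp [Fin.ext_iff, Nat.mod_eq_of_lt]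
theorem l03 : (0 : L N) ≠ 3 := by simp [Fin.ext_iff, Nat.mod_eq_of_lt]
theorem l30 : (3 : L N) ≠ 0 := by simp [Fin.ext_iff, Nat.mod_eq_of_lt]
theorem l13 : (1 : L N) ≠ 3 := by simp [Fin.ext_iff, Nat.mod_eq_of_lt]
theorem l31 : (3 : L N) ≠ 1 := by simp [Fin.ext_iff, Nat.mod_eq_of_lt]
theorem l23 : (2 : L N) ≠ 3 := by simp [Fin.ext_iff, Nat.mod_eq_of_lt]
theorem l32 : (3 : L N) ≠ 2 := by simp [Fin.ext_iff, Nat.mod_eq_of_lt]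

/-- Prepend a letter. -/
def cons (i : L N) (s : K N) : K N := fun k => Nat.casesOn k i s
/-- Drop the first letter. -/
def tl (s : K N) : K N := fun k => s (k + 1)

@[simp] theorem cons_zero (i : L N) (s : K N) : cons i s 0 = i := rfl
@[simp] theorem cons_succ (i : L N) (s : K N) (k : ℕ) : cons i s (k + 1) = s k := rfl
@[simp] theorem tl_cons (i : L N) (s : K N) : tl (cons i s) = s := rfl
@[simp] theorem cons_tl (s : K N) : cons (s 0) (tl s) = s := by
  funext k; cases k <;> rfl

theorem continuous_cons (i : L N) : Continuous (cons i : K N → K N) := by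
  refine continuous_pi fun k => ?_
  cases k with
  | zero => exact continuous_const
  | succ k => exact continuous_apply k

theorem continuous_tl : Continuous (tl : K N → K N) :=
  continuous_pi fun k => continuous_apply (k + 1)

def bK : K N := fun _ => 1
def aK : K N := cons 0 bK

theorem aK_ne_bK : (aK : K N) ≠ bK := fun h => l01 (congrFun h 0)
theorem tl_bK : tl (bK : K N) = bK := rfl

inductive Rel : K N → K N → Prop
  | refl (s : K N) : Rel s s
  | glue (i j : L N) : Rel (cons i aK) (cons j aK)
  | cons (i : L N) (s t : K N) : Rel s t → Rel (cons i s) (cons i t)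

theorem Rel.inversion {s t : K N} (h : Rel s t) :
    (s 0 = t 0 ∧ Rel (tl s) (tl t)) ∨ (tl s = aK ∧ tl t = aK) := by
  cases h with
  | refl => exact Or.inl ⟨rfl, Rel.refl _⟩
  | glue i j => exact Or.inr ⟨rfl, rfl⟩
  | cons i s t h => exact Or.inl ⟨rfl, h⟩

theorem Rel.symm {s t : K N} (h : Rel s t) : Rel t s := by
  induction h with
  | refl s => exact Rel.refl s
  | glue i j => exact Rel.glue j i
  | cons i s t _ ih => exact Rel.cons i t s ih

theorem Rel.bK {s t : K N} (h : Rel s t) : s = bK → t = bK := by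
  induction h with
  | refl s => exact id
  | glue i j => intro h; exact absurd (congrArg tl h) aK_ne_bK
  | cons i s t _ ih =>
    intro h
    have h1 : s = Waz.bK := congrArg tl h
    have h2 : i = 1 := congrFun h 0
    rw [ih h1, h2]
    exact cons_tl (Waz.bK : K N)

theorem Rel.aK {t : K N} (h : Rel aK t) : t = aK := by
  rcases h.inversion with ⟨h0, h1⟩ | ⟨h1, -⟩
  · have h2 : tl t = Waz.bK := h1.bK rfl
    rw [← cons_tl t, h2, ← h0]; rfl
  · exact absurd h1.symm aK_ne_bK

theorem Rel.trans {s t u : K N} (h : Rel s t) : Rel t u → Rel s u := by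
  induction h generalizing u with
  | refl s => exact id
  | glue i j =>
    intro h
    have h2 : tl u = Waz.aK := by
      rcases h.inversion with ⟨-, h1⟩ | ⟨-, h1⟩
      · exact Rel.aK h1
      · exact h1
    rw [← cons_tl u, h2]; exact Rel.glue _ _
  | cons i s t hst ih =>
    intro h
    rcases h.inversion with ⟨h0, h1⟩ | ⟨h1, h2⟩
    · rw [← cons_tl u, ← h0]; exact Rel.cons _ _ _ (ih h1)
    · have h1 : t = Waz.aK := h1
      rw [h1] at hst
      rw [← cons_tl u, h2, Rel.aK hst.symm]; exact Rel.glue _ _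

instance relSetoid (N : ℕ) : Setoid (K N) where
  r := Rel
  iseqv := ⟨Rel.refl, Rel.symm, Rel.trans⟩

/-- The dendrite. -/
def Dend (N : ℕ) : Type := Quotient (relSetoid N)

instance : TopologicalSpace (Dend N) := inferInstanceAs (TopologicalSpace (Quotient _))
instance : CompactSpace (Dend N) := inferInstanceAs (CompactSpace (Quotient _))

/-- The coding map. -/
def q (s : K N) : Dend N := Quotient.mk _ s

theorem q_surj : Function.Surjective (q : K N → Dend N) := Quotient.mk_surjective
theorem continuous_q : Continuous (q : K N → Dend N) := continuous_quotient_mk'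
theorem q_quot : IsQuotientMap (q : K N → Dend N) := isQuotientMap_quotient_mk'
theorem q_eq {s t : K N} : q s = q t ↔ Rel s t := Quotient.eq

def a : Dend N := q aK
def b : Dend N := q bK

/-- The cell maps. -/
def f (i : L N) : Dend N → Dend N :=
  Quotient.map (cons i) (fun s t h => Rel.cons i s t h)

theorem f_q (i : L N) (s : K N) : f i (q s) = q (cons i s) := rfl
theorem q_eq_f (s : K N) : q s = f (s 0) (q (tl s)) := by rw [f_q, cons_tl]

theorem cont_f (i : L N) : Continuous (f i) := by
  rw [q_quot.continuous_iff]
  exact continuous_q.comp (continuous_cons i)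

/-- The root branch point. -/
def p : Dend N := f 0 a

theorem f_a (i : L N) : f i a = p := q_eq.2 (Rel.glue _ _)
theorem f_0_b : f 0 (b : Dend N) = a := rfl
theorem f_1_b : f 1 (b : Dend N) = b := congrArg q (cons_tl bK)

theorem a_ne_b : (a : Dend N) ≠ b := by
  intro h
  have := Rel.aK (q_eq.1 h)
  exact aK_ne_bK this.symm

theorem b_ne_a : (b : Dend N) ≠ a := a_ne_b.symm

theorem q_eq_a {s : K N} (h : q s = a) : s = aK := Rel.aK (q_eq.1 h).symm
theorem q_eq_b {s : K N} (h : q s = b) : s = bK := Rel.bK (q_eq.1 h).symm rfl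

theorem cover (x : Dend N) : ∃ i y, f i y = x := by
  obtain ⟨s, rfl⟩ := q_surj x
  exact ⟨s 0, q (tl s), (q_eq_f s).symm⟩

theorem f_eq {i j : L N} {x y : Dend N} : f i x = f j y ↔ (i = j ∧ x = y) ∨ (x = a ∧ y = a) := by
  constructor
  · obtain ⟨s, rfl⟩ := q_surj x
    obtain ⟨t, rfl⟩ := q_surj y
    rw [f_q, f_q, q_eq]
    intro h
    rcases h.inversion with ⟨h0, h1⟩ | ⟨h1, h2⟩
    · exact Or.inl ⟨h0, q_eq.2 h1⟩
    · exact Or.inr ⟨congrArg q h1, congrArg q h2⟩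
  · rintro (⟨rfl, rfl⟩ | ⟨rfl, rfl⟩)
    · rfl
    · rw [f_a, f_a]

theorem f_inj (i : L N) : Function.Injective (f i) := by
  intro x y h
  rcases f_eq.1 h with ⟨-, h⟩ | ⟨h1, h2⟩
  · exact h
  · rw [h1, h2]

@[simp] theorem f_inj_iff (i : L N) {x y : Dend N} : f i x = f i y ↔ x = y := (f_inj i).eq_iff

theorem f_eq_ne {i j : L N} (hij : i ≠ j) {x y : Dend N} : f i x = f j y ↔ (x = a ∧ y = a) := by
  rw [f_eq]; simp [hij]

theorem f_eq_p {i : L N} {x : Dend N} : f i x = p ↔ x = a := by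
  rw [← f_a i, f_inj_iff]

theorem f_eq_a {i : L N} {x : Dend N} : f i x = a ↔ i = 0 ∧ x = b := by
  rw [← f_0_b, f_eq]
  simp [b_ne_a]

theorem f_eq_b {i : L N} {x : Dend N} : f i x = b ↔ i = 1 ∧ x = b := by
  conv_lhs => rw [← f_1_b]
  rw [f_eq]
  simp [b_ne_a]

theorem p_ne_a : (p : Dend N) ≠ a := by
  rw [p, Ne, f_eq_a]; simp [a_ne_b]
theorem p_ne_b : (p : Dend N) ≠ b := by
  rw [p, Ne, f_eq_b]; simp [a_ne_b]

/-- Continuity can be checked on cells. -/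
theorem cont_of_cells {Y : Type*} [TopologicalSpace Y] {F : Dend N → Y}
    (h : ∀ i, Continuous (fun x => F (f i x))) : Continuous F := by
  rw [q_quot.continuous_iff]
  have h1 : Continuous (fun z : L N × Dend N => F (f z.1 z.2)) := by
    rw [continuous_prod_of_discrete_left]
    exact h
  have h2 : (F ∘ q) = (fun z : L N × Dend N => F (f z.1 z.2)) ∘ (fun s : K N => (s 0, q (tl s))) := by
    funext s
    simp [← q_eq_f]
  rw [h2]
  exact h1.comp ((continuous_apply 0).prodMk (continuous_q.comp continuous_tl))

theorem isOpen_of_cells {U : Set (Dend N)} (h : ∀ i, IsOpen (f i ⁻¹' U)) : IsOpen U := by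
  refine continuous_Prop.1 (?_ : Continuous (fun x => x ∈ U))
  refine cont_of_cells fun i => ?_
  exact continuous_Prop.2 (h i)

open Classical in
/-- Glue maps given on the cells. -/
noncomputable def glue {Y : Type*} (h : L N → Dend N → Y) (x : Dend N) : Y :=
  h (cover x).choose (cover x).choose_spec.choose

theorem glue_f {Y : Type*} {h : L N → Dend N → Y} (hc : ∀ i j, h i a = h j a) (i : L N) (x : Dend N) :
    glue h (f i x) = h i x := by
  have := (cover (f i x)).choose_spec.choose_spec
  rw [glue]
  rcases f_eq.1 this with ⟨h1, h2⟩ | ⟨h1, h2⟩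
  · exact congrArg₂ h h1 h2
  · rw [h1, h2]; exact hc _ _

theorem cont_glue {Y : Type*} [TopologicalSpace Y] {h : L N → Dend N → Y} (hc : ∀ i j, h i a = h j a)
    (hh : ∀ i, Continuous (h i)) : Continuous (glue h) := by
  refine cont_of_cells fun i => ?_
  simp only [glue_f hc]
  exact hh i

/-- Induction principle: it suffices to check equality on cells. -/
theorem cells_ext {Y : Type*} {F G : Dend N → Y} (h : ∀ i x, F (f i x) = G (f i x)) (x : Dend N) :
    F x = G x := by
  obtain ⟨i, y, rfl⟩ := cover x
  exact h i y

/-- Word maps. -/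
def fw : List (L N) → Dend N → Dend N
  | [] => id
  | i :: w => f i ∘ fw w

@[simp] theorem fw_nil (x : Dend N) : fw [] x = x := rfl
@[simp] theorem fw_cons (i : L N) (w : List (L N)) (x : Dend N) : fw (i :: w) x = f i (fw w x) := rfl
theorem fw_append (v w : List (L N)) (x : Dend N) : fw (v ++ w) x = fw v (fw w x) := by
  induction v with
  | nil => rfl
  | cons i v ih => simp [ih]
theorem cont_fw (w : List (L N)) : Continuous (fw w) := by
  induction w with
  | nil => exact continuous_id
  | cons i w ih => exact (cont_f i).comp ih
theorem fw_inj (w : List (L N)) : Function.Injective (fw w) := by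
  induction w with
  | nil => exact Function.injective_id
  | cons i w ih => exact (f_inj i).comp ih

/-- Branch points. -/
def pw (w : List (L N)) : Dend N := fw w p

@[simp] theorem pw_nil : (pw [] : Dend N) = p := rfl
@[simp] theorem pw_cons (i : L N) (w : List (L N)) : pw (i :: w) = f i (pw w) := rfl

theorem pw_ne_b (w : List (L N)) : pw w ≠ b := by
  induction w with
  | nil => exact p_ne_b
  | cons i w ih => rw [pw_cons, Ne, f_eq_b]; exact fun h => ih h.2

theorem pw_ne_a (w : List (L N)) : pw w ≠ a := by
  cases w with
  | nil => exact p_ne_a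
  | cons i w => rw [pw_cons, Ne, f_eq_a]; exact fun h => pw_ne_b w h.2

/-! ### Homeomorphisms -/

theorem mul_ap (g h : Dend N ≃ₜ Dend N) (x : Dend N) : (g * h) x = g (h x) := rfl
theorem one_ap (x : Dend N) : (1 : Dend N ≃ₜ Dend N) x = x := rfl
theorem inv_ap (g : Dend N ≃ₜ Dend N) (x : Dend N) : g⁻¹ (g x) = x := g.symm_apply_apply x
theorem ap_inv (g : Dend N ≃ₜ Dend N) (x : Dend N) : g (g⁻¹ x) = x := g.apply_symm_apply x
theorem inv_eq_iff {g : Dend N ≃ₜ Dend N} {x y : Dend N} : g⁻¹ x = y ↔ x = g y := by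
  constructor
  · rintro rfl; rw [ap_inv]
  · rintro rfl; rw [inv_ap]
theorem homeo_ext {g h : Dend N ≃ₜ Dend N} (H : ∀ x, g x = h x) : g = h := Homeomorph.ext H

def mkH (F G : Dend N → Dend N) (hF : Continuous F) (hG : Continuous G)
    (h1 : ∀ i x, G (F (f i x)) = f i x) (h2 : ∀ i x, F (G (f i x)) = f i x) : Dend N ≃ₜ Dend N where
  toFun := F
  invFun := G
  left_inv := cells_ext (G := id) h1
  right_inv := cells_ext (G := id) h2
  continuous_toFun := hF
  continuous_invFun := hG

/-- Rigid permutation of the cells. -/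
noncomputable def perm (π : Equiv.Perm (L N)) : Dend N ≃ₜ Dend N :=
  mkH (glue fun i => f (π i)) (glue fun i => f (π⁻¹ i))
    (cont_glue (fun i j => by rw [f_a, f_a]) fun i => cont_f _)
    (cont_glue (fun i j => by rw [f_a, f_a]) fun i => cont_f _)
    (fun i x => by
      rw [glue_f (fun i j => by rw [f_a, f_a]), glue_f (fun i j => by rw [f_a, f_a])]; simp)
    (fun i x => by
      rw [glue_f (fun i j => by rw [f_a, f_a]), glue_f (fun i j => by rw [f_a, f_a])]; simp)

theorem perm_f (π : Equiv.Perm (L N)) (i : L N) (x : Dend N) : perm π (f i x) = f (π i) x :=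
  glue_f (h := fun i => f (π i)) (fun i j => by rw [f_a, f_a]) i x

theorem perm_mul (π π' : Equiv.Perm (L N)) : perm (π * π') = perm π * perm π' :=
  homeo_ext <| cells_ext fun i x => by simp [mul_ap, perm_f]
theorem perm_one : perm (1 : Equiv.Perm (L N)) = 1 :=
  homeo_ext <| cells_ext fun i x => by simp [one_ap, perm_f]
theorem perm_inv (π : Equiv.Perm (L N)) : perm (π⁻¹) = (perm π)⁻¹ :=
  eq_inv_of_mul_eq_one_left (by rw [← perm_mul, inv_mul_cancel, perm_one])
theorem perm_p (π : Equiv.Perm (L N)) : perm π p = p := by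
  rw [← f_a 0, perm_f, f_a, f_a]
theorem perm_a {π : Equiv.Perm (L N)} (h : π 0 = 0) : perm π a = a := by
  rw [← f_0_b, perm_f, h]
theorem perm_b {π : Equiv.Perm (L N)} (h : π 1 = 1) : perm π b = b := by
  conv_lhs => rw [← f_1_b, perm_f, h, f_1_b]

/-- Swap of the two ends. -/
noncomputable def sg : Dend N ≃ₜ Dend N := perm (Equiv.swap 0 1)

theorem sg_0 (x : Dend N) : sg (f 0 x) = f 1 x := by rw [sg, perm_f]; simp
theorem sg_1 (x : Dend N) : sg (f 1 x) = f 0 x := by rw [sg, perm_f]; simp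
theorem sg_i {i : L N} (h0 : i ≠ 0) (h1 : i ≠ 1) (x : Dend N) : sg (f i x) = f i x := by
  rw [sg, perm_f, Equiv.swap_apply_of_ne_of_ne h0 h1]
theorem sg_a : sg (a : Dend N) = b := by rw [← f_0_b, sg_0, f_1_b]
theorem sg_b : sg (b : Dend N) = a := by conv_lhs => rw [← f_1_b, sg_1, f_0_b]
theorem sg_p : sg (p : Dend N) = p := perm_p _
theorem sg_sg (x : Dend N) : sg (sg x) = x := by
  have : (sg : Dend N ≃ₜ Dend N) * sg = 1 := by rw [sg, ← perm_mul, Equiv.swap_mul_self, perm_one]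
  rw [← mul_ap, this, one_ap]
theorem sg_inv : (sg : Dend N ≃ₜ Dend N)⁻¹ = sg := by rw [sg, ← perm_inv, Equiv.swap_inv]

/-- The map supported on the cell `i` induced by `h`. -/
noncomputable def sup (i : L N) (h : Dend N ≃ₜ Dend N) (ha : h a = a) : Dend N ≃ₜ Dend N :=
  have ha' : h⁻¹ a = a := inv_eq_iff.2 ha.symm
  have hc : ∀ h : Dend N ≃ₜ Dend N, h a = a →
      ∀ j k : L N, (if j = i then f j (h a) else f j a) = (if k = i then f k (h a) else f k a) := by
    intro h ha j k; simp [ha, f_a]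
  have cc : ∀ h : Dend N ≃ₜ Dend N, ∀ j, Continuous (fun x => if j = i then f j (h x) else f j x) := by
    intro h j
    by_cases hj : j = i
    · simp only [hj, if_true]; exact (cont_f i).comp h.continuous
    · simp only [hj, if_false]; exact cont_f j
  mkH (glue fun j x => if j = i then f j (h x) else f j x)
    (glue fun j x => if j = i then f j (h⁻¹ x) else f j x)
    (cont_glue (hc h ha) (cc h)) (cont_glue (hc _ ha') (cc _))
    (fun j x => by
      rw [glue_f (hc h ha)]
      by_cases hj : j = i
      · simp only [hj, if_true]; rw [glue_f (hc _ ha')]; simp [inv_ap]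
      · simp only [hj, if_false]; rw [glue_f (hc _ ha')]; simp [hj])
    (fun j x => by
      rw [glue_f (hc _ ha')]
      by_cases hj : j = i
      · simp only [hj, if_true]; rw [glue_f (hc _ ha)]; simp [ap_inv]
      · simp only [hj, if_false]; rw [glue_f (hc _ ha)]; simp [hj])

theorem sup_self {i : L N} {h : Dend N ≃ₜ Dend N} {ha : h a = a} (x : Dend N) :
    sup i h ha (f i x) = f i (h x) := by
  have := glue_f (h := fun j x => if j = i then f j (h x) else f j x)
    (by intro j k; simp [ha, f_a]) i x
  simp only [if_true] at this
  exact this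
theorem sup_ne {i j : L N} (hij : j ≠ i) {h : Dend N ≃ₜ Dend N} {ha : h a = a} (x : Dend N) :
    sup i h ha (f j x) = f j x := by
  have := glue_f (h := fun j x => if j = i then f j (h x) else f j x)
    (by intro j k; simp [ha, f_a]) j x
  simp only [hij, if_false] at this
  exact this
theorem sup_a {i : L N} {h : Dend N ≃ₜ Dend N} {ha : h a = a} (hb : i ≠ 0 ∨ h b = b) :
    sup i h ha a = a := by
  rw [← f_0_b]
  by_cases hi : 0 = i
  · subst hi
    rw [sup_self, hb.resolve_left (by simp)]
  · rw [sup_ne hi]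
theorem sup_b {i : L N} {h : Dend N ≃ₜ Dend N} {ha : h a = a} (hb : i ≠ 1 ∨ h b = b) :
    sup i h ha b = b := by
  by_cases hi : 1 = i
  · subst hi
    conv_lhs => rw [← f_1_b]
    rw [sup_self, hb.resolve_left (by simp), f_1_b]
  · conv_lhs => rw [← f_1_b, sup_ne hi, f_1_b]
theorem sup_p {i : L N} {h : Dend N ≃ₜ Dend N} {ha : h a = a} : sup i h ha p = p := by
  rw [← f_a i, sup_self, ha]

/-- First half of the definition of `rho`. -/
noncomputable def rho1 : Dend N → Dend N :=
  glue fun i x => if i = 0 then f 1 (f 0 (sg x)) else if i = 1 then f 0 x else f i x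

theorem rho1_c : ∀ i j : L N,
    (if i = 0 then f 1 (f 0 (sg (a : Dend N))) else if i = 1 then f 0 a else f i a) =
    (if j = 0 then f 1 (f 0 (sg (a : Dend N))) else if j = 1 then f 0 a else f j a) := by
  intro i j
  simp [sg_a, f_0_b, f_a]

theorem rho1_f (i : L N) (x : Dend N) : rho1 (f i x) =
    if i = 0 then f 1 (f 0 (sg x)) else if i = 1 then f 0 x else f i x :=
  glue_f rho1_c i x

theorem cont_rho1 : Continuous (rho1 : Dend N → Dend N) := by
  refine cont_glue rho1_c fun i => ?_
  by_cases h0 : i = 0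
  · simp only [h0, if_true]; exact (cont_f 1).comp ((cont_f 0).comp sg.continuous)
  · by_cases h1 : i = 1
    · simp only [h1, l10, if_true, if_false]; exact cont_f 0
    · simp only [h0, h1, if_false]; exact cont_f i

noncomputable def rhoF : Dend N → Dend N :=
  glue fun i x => if i = 0 then f 1 (f 1 x) else if i = 1 then rho1 x else f 1 (f i x)

theorem rhoF_c : ∀ i j : L N,
    (if i = 0 then f 1 (f 1 (a : Dend N)) else if i = 1 then rho1 a else f 1 (f i a)) =
    (if j = 0 then f 1 (f 1 (a : Dend N)) else if j = 1 then rho1 a else f 1 (f j a)) := by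
  intro i j
  have : rho1 (a : Dend N) = f 1 p := by
    conv_lhs => rw [← f_0_b, rho1_f, if_pos rfl, sg_b, f_a]
  simp [this, f_a]

theorem rhoF_f (i : L N) (x : Dend N) : rhoF (f i x) =
    if i = 0 then f 1 (f 1 x) else if i = 1 then rho1 x else f 1 (f i x) :=
  glue_f rhoF_c i x

theorem cont_rhoF : Continuous (rhoF : Dend N → Dend N) := by
  refine cont_glue rhoF_c fun i => ?_
  by_cases h0 : i = 0
  · simp only [h0, if_true]; exact (cont_f 1).comp (cont_f 1)
  · by_cases h1 : i = 1
    · simp only [h1, l10, if_true, if_false]; exact cont_rho1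
    · simp only [h0, h1, if_false]; exact (cont_f 1).comp (cont_f i)

theorem rhoF_rhoF (i : L N) (x : Dend N) : rhoF (rhoF (f i x)) = f i x := by
  by_cases h0 : i = 0
  · subst h0; simp [rhoF_f, rho1_f, l10]
  · by_cases h1 : i = 1
    · subst h1
      rw [rhoF_f, if_neg l10, if_pos rfl]
      refine cells_ext (F := fun x => rhoF (rho1 x)) (G := f 1) ?_ x
      intro j y
      by_cases h0 : j = 0
      · subst h0; simp [rhoF_f, rho1_f, l10, sg_sg]
      · by_cases h1 : j = 1
        · subst h1; simp [rhoF_f, rho1_f, l10]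
        · simp [rhoF_f, rho1_f, l10, h0, h1]
    · simp [rhoF_f, rho1_f, l10, h0, h1]

noncomputable def rho : Dend N ≃ₜ Dend N := mkH rhoF rhoF cont_rhoF cont_rhoF rhoF_rhoF rhoF_rhoF

theorem rho_ap (x : Dend N) : rho x = rhoF x := rfl

noncomputable def g : Dend N ≃ₜ Dend N := rho * sg

theorem g_00 (x : Dend N) : g (f 0 (f 0 x)) = f 1 (f 0 (sg x)) := by
  simp [g, mul_ap, sg_0, rho_ap, rhoF_f, rho1_f, l10]
theorem g_01 (x : Dend N) : g (f 0 (f 1 x)) = f 0 x := by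
  simp [g, mul_ap, sg_0, rho_ap, rhoF_f, rho1_f, l10]
theorem g_0i {i : L N} (h0 : i ≠ 0) (h1 : i ≠ 1) (x : Dend N) : g (f 0 (f i x)) = f i x := by
  simp [g, mul_ap, sg_0, rho_ap, rhoF_f, rho1_f, h0, h1]
theorem g_1 (x : Dend N) : g (f 1 x) = f 1 (f 1 x) := by
  simp [g, mul_ap, sg_1, rho_ap, rhoF_f]
theorem g_i {i : L N} (h0 : i ≠ 0) (h1 : i ≠ 1) (x : Dend N) : g (f i x) = f 1 (f i x) := by
  simp [g, mul_ap, sg_i, rho_ap, rhoF_f, h0, h1]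

theorem gi_0 (x : Dend N) : g⁻¹ (f 0 x) = f 0 (f 1 x) := inv_eq_iff.2 (g_01 x).symm
theorem gi_10 (x : Dend N) : g⁻¹ (f 1 (f 0 x)) = f 0 (f 0 (sg x)) :=
  inv_eq_iff.2 (by rw [g_00, sg_sg])
theorem gi_11 (x : Dend N) : g⁻¹ (f 1 (f 1 x)) = f 1 x := inv_eq_iff.2 (g_1 x).symm
theorem gi_1i {i : L N} (h0 : i ≠ 0) (h1 : i ≠ 1) (x : Dend N) : g⁻¹ (f 1 (f i x)) = f i x :=
  inv_eq_iff.2 (g_i h0 h1 x).symm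
theorem gi_i {i : L N} (h0 : i ≠ 0) (h1 : i ≠ 1) (x : Dend N) : g⁻¹ (f i x) = f 0 (f i x) :=
  inv_eq_iff.2 (g_0i h0 h1 x).symm

theorem g_a : g (a : Dend N) = a := by
  conv_lhs => rw [← f_0_b, ← f_1_b, g_01, f_0_b]
theorem g_b : g (b : Dend N) = b := by
  conv_lhs => rw [← f_1_b, g_1, f_1_b, f_1_b]
theorem gi_a : g⁻¹ (a : Dend N) = a := inv_eq_iff.2 g_a.symm
theorem gi_b : g⁻¹ (b : Dend N) = b := inv_eq_iff.2 g_b.symm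

theorem sg_g_sg : sg * g * sg = (g : Dend N ≃ₜ Dend N)⁻¹ := by
  have : (g : Dend N ≃ₜ Dend N)⁻¹ = sg * rho := by
    rw [g, mul_inv_rev, sg_inv]
    congr 1
  rw [this, g]
  refine homeo_ext fun x => ?_
  simp only [mul_ap, sg_sg]

/-- `sup 0 g`. -/
noncomputable def s0g : Dend N ≃ₜ Dend N := sup 0 g g_a
theorem s0g_a : s0g (a : Dend N) = a := sup_a (Or.inr g_b)
theorem s0g_b : s0g (b : Dend N) = b := sup_b (Or.inr g_b)
/-- `sup 1 g`. -/
noncomputable def s1g : Dend N ≃ₜ Dend N := sup 1 g g_a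
theorem s1g_a : s1g (a : Dend N) = a := sup_a (Or.inr g_b)
theorem s1g_b : s1g (b : Dend N) = b := sup_b (Or.inr g_b)

noncomputable def kin : Dend N ≃ₜ Dend N := g * s0g * g⁻¹
theorem kin_a : kin (a : Dend N) = a := by simp only [kin, mul_ap, gi_a, s0g_a, g_a]
theorem kin_b : kin (b : Dend N) = b := by simp only [kin, mul_ap, gi_b, s0g_b, g_b]

noncomputable def kap : Dend N ≃ₜ Dend N := g⁻¹ * sup 1 kin kin_a * g

theorem kap_i {i : L N} (h0 : i ≠ 0) (h1 : i ≠ 1) (x : Dend N) :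
    kap (f i x) = f 0 (f 0 (f i x)) := by
  simp only [kap, mul_ap, kin, s0g, g_i h0 h1, sup_self, gi_i h0 h1, g_01, gi_10, sg_sg, sg_i h0 h1]
theorem kap_00 (x : Dend N) : kap (f 0 (f 0 x)) = f 0 (f 0 (f 0 (sg x))) := by
  simp only [kap, mul_ap, kin, s0g, sup_self, g_00, gi_0, g_01, g_1, gi_10, sg_1]
theorem kap_01 (x : Dend N) : kap (f 0 (f 1 x)) = f 0 (f 1 x) := by
  simp only [kap, mul_ap, g_01, sup_ne l01, gi_0]
theorem kap_0i {i : L N} (h0 : i ≠ 0) (h1 : i ≠ 1) (x : Dend N) :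
    kap (f 0 (f i x)) = f 0 (f i x) := by
  simp only [kap, mul_ap, g_0i h0 h1, sup_ne h1, gi_i h0 h1]
theorem kap_11 (x : Dend N) : kap (f 1 (f 1 x)) = f 1 (f 1 x) := by
  simp only [kap, mul_ap, kin, s0g, g_1, sup_self, gi_11, sup_ne l10]
theorem kap_1i {i : L N} (h0 : i ≠ 0) (h1 : i ≠ 1) (x : Dend N) :
    kap (f 1 (f i x)) = f 1 (f i x) := by
  simp only [kap, mul_ap, kin, s0g, g_1, g_i h0 h1, sup_self, gi_11, gi_1i h0 h1, sup_ne h0]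
theorem kap_p : kap (p : Dend N) = f 0 (f 0 p) := by
  rw [← f_a 2, kap_i l20 l21]

end Waz

open Topology

namespace Waz
set_option linter.unusedSimpArgs false
set_option linter.unusedSectionVars false

variable {N : ℕ}

/-! ### Separation -/

theorem isClosed_a : IsClosed ({a} : Set (Dend N)) := by
  rw [← q_quot.isClosed_preimage]
  have : q ⁻¹' {(a : Dend N)} = {aK} := by
    ext s; exact ⟨fun h => q_eq_a h, fun h => congrArg q h⟩
  rw [this]; exact isClosed_singleton

/-- Retraction on a cell. -/
noncomputable def ret (j : L N) : Dend N → Dend N := glue fun i x => if i = j then x else a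

theorem ret_f (j i : L N) (x : Dend N) : ret j (f i x) = if i = j then x else a :=
  glue_f (h := fun i x => if i = j then x else a) (by simp) i x

theorem cont_ret (j : L N) : Continuous (ret j) := by
  refine cont_glue (by simp) fun i => ?_
  by_cases h : i = j
  · simp only [h, if_true]; exact continuous_id
  · simp only [h, if_false]; exact continuous_const

/-- The open half-tree at `p` through the cell `i`. -/
def U (i : L N) : Set (Dend N) := f i '' {a}ᶜ

theorem f_mem_U {i j : L N} {x : Dend N} : f j x ∈ U i ↔ j = i ∧ x ≠ a := by
  constructor
  · rintro ⟨y, hy, h⟩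
    rcases f_eq.1 h with ⟨rfl, rfl⟩ | ⟨h1, -⟩
    · exact ⟨rfl, hy⟩
    · exact absurd h1 hy
  · rintro ⟨rfl, h⟩; exact ⟨x, h, rfl⟩

theorem isOpen_U (i : L N) : IsOpen (U i) := by
  refine isOpen_of_cells fun j => ?_
  by_cases h : j = i
  · have : f j ⁻¹' U i = {a}ᶜ := by ext x; simp [f_mem_U, h]
    rw [this]; exact isClosed_a.isOpen_compl
  · have : f j ⁻¹' U i = ∅ := by ext x; simp [f_mem_U, h]
    rw [this]; exact isOpen_empty

theorem U_disj {i j : L N} (h : i ≠ j) : Disjoint (U i) (U j) := by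
  rw [Set.disjoint_left]
  rintro _ ⟨x, hx, rfl⟩ h'
  exact h (f_mem_U.1 h').1

theorem iUnion_U : (⋃ i, U i) = ({p}ᶜ : Set (Dend N)) := by
  ext x
  obtain ⟨i, y, rfl⟩ := cover x
  simp [f_mem_U, f_eq_p]

/-- Points separated by a branch point. -/
def Sep (x y : Dend N) : Prop := ∃ v, ∃ O1 O2 : Set (Dend N), IsOpen O1 ∧ IsOpen O2 ∧ Disjoint O1 O2 ∧
  x ∈ O1 ∧ y ∈ O2 ∧ O1 ∪ O2 = {pw v}ᶜ

theorem Sep.symm {x y : Dend N} : Sep x y → Sep y x := by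
  rintro ⟨v, O1, O2, h1, h2, h3, h4, h5, h6⟩
  exact ⟨v, O2, O1, h2, h1, h3.symm, h5, h4, by rw [Set.union_comm, h6]⟩

theorem Sep.f {x y : Dend N} (j : L N) : Sep x y → Sep (f j x) (f j y) := by
  rintro ⟨v, O1, O2, h1, h2, h3, h4, h5, h6⟩
  refine ⟨j :: v, ret j ⁻¹' O1, ret j ⁻¹' O2, h1.preimage (cont_ret j), h2.preimage (cont_ret j),
    h3.preimage _, by simpa [ret_f] using h4, by simpa [ret_f] using h5, ?_⟩
  rw [← Set.preimage_union, h6]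
  ext z
  obtain ⟨i, z, rfl⟩ := cover z
  simp only [Set.mem_preimage, Set.mem_compl_iff, Set.mem_singleton_iff, ret_f, pw_cons]
  by_cases hi : i = j
  · simp [hi]
  · simp only [hi, if_false, f_eq_ne hi, not_iff_not]
    constructor
    · intro h; exact absurd h.symm (pw_ne_a v)
    · intro h; exact absurd h.2 (pw_ne_a v)

theorem Sep.cross {i j : L N} (h : i ≠ j) {x y : Dend N} (hx : x ≠ a) (hy : y ≠ a) :
    Sep (Waz.f i x) (Waz.f j y) := by
  refine ⟨[], U i, ⋃ k ∈ {k : L N | k ≠ i}, U k, isOpen_U i, isOpen_biUnion fun k _ => isOpen_U k, ?_,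
    f_mem_U.2 ⟨rfl, hx⟩, ?_, ?_⟩
  · rw [Set.disjoint_iUnion₂_right]
    intro k hk; exact U_disj (Ne.symm hk)
  · exact Set.mem_biUnion (x := j) h.symm (f_mem_U.2 ⟨rfl, hy⟩)
  · rw [pw_nil, ← iUnion_U]
    ext z
    simp only [Set.mem_union, Set.mem_iUnion, Set.mem_setOf_eq, exists_prop]
    constructor
    · rintro (h | ⟨k, -, h⟩)
      exacts [⟨_, h⟩, ⟨_, h⟩]
    · rintro ⟨k, hz⟩
      by_cases hk : k = i
      · exact Or.inl (hk ▸ hz)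
      · exact Or.inr ⟨k, hk, hz⟩

theorem sep_b_a : Sep (b : Dend N) a := by
  have := Sep.cross (l10 (N := N)) (b_ne_a (N := N)) (b_ne_a (N := N))
  rwa [f_1_b, f_0_b] at this

theorem sepB' (m : ℕ) : ∀ s : K N, s m ≠ 1 → Sep b (q s) := by
  induction m with
  | zero =>
    intro s hs
    rw [q_eq_f]
    by_cases h : q (tl s) = a
    · rw [h, f_a, ← f_a 1]
      have := sep_b_a (N := N).f 1
      rwa [f_1_b] at this
    · have := Sep.cross (Ne.symm hs) (b_ne_a (N := N)) h
      rwa [f_1_b] at this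
  | succ m ih =>
    intro s hs
    rw [q_eq_f]
    by_cases h0 : s 0 = 1
    · rw [h0]
      have := (ih (tl s) hs).f 1
      rwa [f_1_b] at this
    · by_cases h : q (tl s) = a
      · rw [h, f_a, ← f_a 1]
        have := sep_b_a (N := N).f 1
        rwa [f_1_b] at this
      · have := Sep.cross (Ne.symm h0) (b_ne_a (N := N)) h
        rwa [f_1_b] at this

theorem exists_ne_one {s : K N} (h : q s ≠ b) : ∃ m, s m ≠ 1 := by
  by_contra! h'
  exact h (congrArg q (funext h'))

theorem sepB {z : Dend N} (h : z ≠ b) : Sep b z := by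
  obtain ⟨s, rfl⟩ := q_surj z
  obtain ⟨m, hm⟩ := exists_ne_one h
  exact sepB' m s hm

theorem sepA {z : Dend N} (h : z ≠ a) : Sep a z := by
  obtain ⟨j, y, rfl⟩ := cover z
  by_cases hj : j = 0
  · subst hj
    have hy : y ≠ b := by rintro rfl; exact h f_0_b
    have := (sepB hy).f 0
    rwa [f_0_b] at this
  · by_cases hy : y = a
    · rw [hy, f_a, ← f_a 0]
      have := sep_b_a (N := N).f 0
      rwa [f_0_b] at this
    · have := Sep.cross (Ne.symm hj) (b_ne_a (N := N)) hy
      rwa [f_0_b] at this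

theorem sep' (m : ℕ) : ∀ s t : K N, s m ≠ t m → q s ≠ q t → Sep (q s) (q t) := by
  have key : ∀ s t : K N, s 0 ≠ t 0 → q s ≠ q t → Sep (q s) (q t) := by
    intro s t h hne
    rw [q_eq_f s, q_eq_f t] at hne ⊢
    by_cases hx : q (tl s) = a
    · rw [hx, f_a, ← f_a (t 0)] at hne ⊢
      refine (sepA ?_).f _
      rintro h; rw [h] at hne; exact hne rfl
    · by_cases hy : q (tl t) = a
      · rw [hy, f_a, ← f_a (s 0)] at hne ⊢
        exact (sepA hx).symm.f _
      · exact Sep.cross h hx hy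
  induction m with
  | zero => exact key
  | succ m ih =>
    intro s t h hne
    by_cases h0 : s 0 = t 0
    · rw [q_eq_f s, q_eq_f t, h0] at hne ⊢
      refine (ih (tl s) (tl t) h ?_).f _
      intro h; rw [h] at hne; exact hne rfl
    · exact key s t h0 hne

theorem sep_of_ne {x y : Dend N} (h : x ≠ y) : Sep x y := by
  obtain ⟨s, rfl⟩ := q_surj x
  obtain ⟨t, rfl⟩ := q_surj y
  have : ∃ m, s m ≠ t m := by
    by_contra! h'
    exact h (congrArg q (funext h'))
  obtain ⟨m, hm⟩ := this
  exact sep' m s t hm h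

instance : T2Space (Dend N) := by
  refine ⟨fun x y h => ?_⟩
  obtain ⟨v, O1, O2, h1, h2, h3, h4, h5, h6⟩ := sep_of_ne h
  exact ⟨O1, O2, h1, h2, h4, h5, h3⟩

/-! ### Cells shrink -/

theorem fw_code (m : ℕ) : ∀ s : K N, ∃ w : List (L N), w.length = m ∧ ∃ x, q s = fw w x := by
  induction m with
  | zero => intro s; exact ⟨[], rfl, q s, rfl⟩
  | succ m ih =>
    intro s
    obtain ⟨w, hw, x, hx⟩ := ih (tl s)
    exact ⟨s 0 :: w, by simp [hw], x, by rw [q_eq_f, hx, fw_cons]⟩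

theorem cell_cover (m : ℕ) (x : Dend N) : ∃ w : List (L N), w.length = m ∧ ∃ y, x = fw w y := by
  obtain ⟨s, rfl⟩ := q_surj x
  exact fw_code m s

theorem fw_codes (w : List (L N)) : ∀ s t : K N, ∃ s' t' : K N, (∀ k < w.length, s' k = t' k) ∧
    q s' = fw w (q s) ∧ q t' = fw w (q t) := by
  induction w with
  | nil => intro s t; exact ⟨s, t, by simp, rfl, rfl⟩
  | cons i w ih =>
    intro s t
    obtain ⟨s', t', h, h1, h2⟩ := ih s t
    refine ⟨cons i s', cons i t', ?_, by rw [fw_cons, ← h1]; rfl, by rw [fw_cons, ← h2]; rfl⟩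
    intro k hk
    cases k with
    | zero => rfl
    | succ k => exact h k (by simpa using hk)

theorem shrink {W : Set (Dend N × Dend N)} (hW : IsOpen W) (hd : ∀ x, (x, x) ∈ W) :
    ∃ m : ℕ, ∀ w : List (L N), w.length = m → ∀ x y, (fw w x, fw w y) ∈ W := by
  let V : ℕ → Set (K N × K N) := fun m => {z | ∀ k < m, z.1 k = z.2 k}
  have hVc : ∀ m, IsClosed (V m) := by
    intro m
    have : V m = ⋂ k : ℕ, ⋂ _ : k < m, {z | z.1 k = z.2 k} := by ext; simp [V]
    rw [this]
    refine isClosed_iInter fun k => isClosed_iInter fun _ => ?_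
    exact isClosed_eq ((continuous_apply k).comp continuous_fst) ((continuous_apply k).comp continuous_snd)
  have hdir : Directed (· ⊇ ·) V := by
    refine directed_of_isDirected_le ?_
    intro m m' h z hz k hk
    exact hz k (lt_of_lt_of_le hk h)
  have hqq : Continuous (fun z : K N × K N => (q z.1, q z.2)) :=
    (continuous_q.comp continuous_fst).prodMk (continuous_q.comp continuous_snd)
  obtain ⟨m, hm⟩ := exists_subset_nhds_of_isCompact' hdir (fun m => (hVc m).isCompact) hVc
    (U := (fun z : K N × K N => (q z.1, q z.2)) ⁻¹' W) (by
      intro z hz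
      refine (hW.preimage hqq).mem_nhds ?_
      have : z.1 = z.2 := by
        funext k
        exact (Set.mem_iInter.1 hz (k + 1)) k (Nat.lt_succ_self k)
      simp only [Set.mem_preimage, this]
      exact hd _)
  refine ⟨m, fun w hw x y => ?_⟩
  obtain ⟨s, rfl⟩ := q_surj x
  obtain ⟨t, rfl⟩ := q_surj y
  obtain ⟨s', t', h, h1, h2⟩ := fw_codes w s t
  rw [hw] at h
  rw [← h1, ← h2]
  exact hm (show (s', t') ∈ V m from h)

/-! ### Connectedness -/

theorem mono_clopen {C : Set (Dend N)} (h : IsClopen C) (x y : Dend N) : x ∈ C ↔ y ∈ C := by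
  have hW : IsOpen (C ×ˢ C ∪ Cᶜ ×ˢ Cᶜ) :=
    (h.isOpen.prod h.isOpen).union (h.compl.isOpen.prod h.compl.isOpen)
  obtain ⟨m, hm⟩ := shrink hW (by intro x; by_cases hx : x ∈ C <;> simp [hx])
  have step : ∀ k, (∀ w : List (L N), w.length = k + 1 → ∀ x y, fw w x ∈ C ↔ fw w y ∈ C) →
      (∀ w : List (L N), w.length = k → ∀ x y, fw w x ∈ C ↔ fw w y ∈ C) := by
    intro k hk w hw
    have : ∀ x, fw w x ∈ C ↔ fw w p ∈ C := by
      intro x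
      obtain ⟨i, x, rfl⟩ := cover x
      have := hk (w ++ [i]) (by simp [hw]) x a
      simpa [fw_append, f_a] using this
    intro x y
    rw [this x, this y]
  have base : ∀ w : List (L N), w.length = m → ∀ x y, fw w x ∈ C ↔ fw w y ∈ C := by
    intro w hw x y
    rcases hm w hw x y with ⟨h1, h2⟩ | ⟨h1, h2⟩
    · exact ⟨fun _ => h2, fun _ => h1⟩
    · exact ⟨fun h => absurd h h1, fun h => absurd h h2⟩
  have all : ∀ k, (∀ w : List (L N), w.length = k → ∀ x y, fw w x ∈ C ↔ fw w y ∈ C) →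
      (∀ w : List (L N), w.length = 0 → ∀ x y, fw w x ∈ C ↔ fw w y ∈ C) := by
    intro k
    induction k with
    | zero => exact id
    | succ k ih => intro h; exact ih (step k h)
  exact all m base [] rfl x y

instance : ConnectedSpace (Dend N) := by
  haveI : Nonempty (Dend N) := ⟨a⟩
  rw [connectedSpace_iff_clopen]
  refine ⟨inferInstance, fun s hs => ?_⟩
  by_cases h : a ∈ s
  · right; ext x; simp [mono_clopen hs x a, h]
  · left; ext x; simp [mono_clopen hs x a, h]

theorem conn_range (w : List (L N)) : IsPreconnected (Set.range (fw w)) :=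
  isPreconnected_range (cont_fw w)

theorem closed_range (w : List (L N)) : IsClosed (Set.range (fw w)) :=
  (isCompact_range (cont_fw w)).isClosed

theorem basic_nhd {x : Dend N} {O : Set (Dend N)} (hx : x ∈ O) (hO : IsOpen O) :
    ∃ m : ℕ, ∀ w : List (L N), w.length = m → x ∈ Set.range (fw w) → Set.range (fw w) ⊆ O := by
  have hW : IsOpen (({x}ᶜ : Set (Dend N)) ×ˢ (Set.univ : Set (Dend N)) ∪ Set.univ ×ˢ O) :=
    (isOpen_compl_singleton.prod isOpen_univ).union (isOpen_univ.prod hO)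
  obtain ⟨m, hm⟩ := shrink hW (by
    intro y
    by_cases hy : y = x
    · subst hy; simp [hx]
    · simp [hy])
  refine ⟨m, fun w hw hxw => ?_⟩
  obtain ⟨y, hy⟩ := hxw
  rintro _ ⟨z, rfl⟩
  rcases hm w hw y z with ⟨h1, -⟩ | ⟨-, h1⟩
  · exact absurd hy h1
  · exact h1

/-- The complement of a finite union of cells. -/
def coF (F : Finset (List (L N))) : Set (Dend N) := (⋃ w ∈ F, Set.range (fw w))ᶜ

theorem isOpen_coF (F : Finset (List (L N))) : IsOpen (coF F) := by
  rw [coF, isOpen_compl_iff]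
  exact F.finite_toSet.isClosed_biUnion fun w _ => closed_range w

theorem exists_coF (m : ℕ) (x : Dend N) : ∃ F : Finset (List (L N)), x ∈ coF F ∧
    ∀ y ∈ coF F, ∃ w : List (L N), w.length = m ∧ x ∈ Set.range (fw w) ∧ y ∈ Set.range (fw w) := by
  classical
  have hfin : {w : List (L N) | w.length = m ∧ x ∉ Set.range (fw w)}.Finite :=
    (List.finite_length_eq (L N) m).subset fun w hw => hw.1
  refine ⟨hfin.toFinset, ?_, ?_⟩
  · simp only [coF, Set.mem_compl_iff, Set.mem_iUnion, not_exists, Set.Finite.mem_toFinset]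
    intro w hw; exact hw.2
  · intro y hy
    obtain ⟨w, hw, z, hz⟩ := cell_cover m y
    refine ⟨w, hw, ?_, ⟨z, hz.symm⟩⟩
    by_contra hx
    apply hy
    simp only [Set.mem_iUnion, Set.Finite.mem_toFinset]
    exact ⟨w, ⟨hw, hx⟩, ⟨z, hz.symm⟩⟩

instance : SecondCountableTopology (Dend N) := by
  have hB : TopologicalSpace.IsTopologicalBasis (Set.range (coF : Finset (List (L N)) → Set (Dend N))) := by
    refine TopologicalSpace.isTopologicalBasis_of_isOpen_of_nhds ?_ ?_
    · rintro _ ⟨F, rfl⟩; exact isOpen_coF F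
    · intro x O hx hO
      obtain ⟨m, hm⟩ := basic_nhd hx hO
      obtain ⟨F, h1, h2⟩ := exists_coF m x
      refine ⟨_, ⟨F, rfl⟩, h1, fun y hy => ?_⟩
      obtain ⟨w, hw, hx, hy⟩ := h2 y hy
      exact hm w hw hx hy
  exact hB.secondCountableTopology (Set.countable_range _)

instance : LocallyConnectedSpace (Dend N) := by
  rw [locallyConnectedSpace_iff_connected_subsets]
  intro x O hO
  obtain ⟨O', hO', hop, hx⟩ := mem_nhds_iff.1 hO
  obtain ⟨m, hm⟩ := basic_nhd hx hop
  obtain ⟨F, h1, h2⟩ := exists_coF m x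
  refine ⟨⋃₀ {s | ∃ w : List (L N), w.length = m ∧ x ∈ Set.range (fw w) ∧ s = Set.range (fw w)}, ?_, ?_, ?_⟩
  · refine Filter.mem_of_superset ((isOpen_coF F).mem_nhds h1) fun y hy => ?_
    obtain ⟨w, hw, hx, hy⟩ := h2 y hy
    exact ⟨_, ⟨w, hw, hx, rfl⟩, hy⟩
  · refine isPreconnected_sUnion x _ ?_ ?_
    · rintro _ ⟨w, hw, hx, rfl⟩; exact hx
    · rintro _ ⟨w, hw, hx, rfl⟩; exact conn_range w
  · rintro y ⟨_, ⟨w, hw, hx, rfl⟩, hy⟩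
    exact hO' (hm w hw hx hy)

theorem metr : TopologicalSpace.MetrizableSpace (Dend N) := inferInstance

theorem pw_mem_of_conn {S : Set (Dend N)} (h : IsPreconnected S) {x y : Dend N} (hx : x ∈ S) (hy : y ∈ S)
    {v : List (L N)} {O1 O2 : Set (Dend N)} (h1 : IsOpen O1) (h2 : IsOpen O2) (hd : Disjoint O1 O2)
    (hx1 : x ∈ O1) (hy1 : y ∈ O2) (hu : O1 ∪ O2 = {pw v}ᶜ) : pw v ∈ S := by
  by_contra hp
  have hsub : S ⊆ O1 ∪ O2 := by
    rw [hu]; intro z hz h; rw [Set.mem_singleton_iff] at h; exact hp (h ▸ hz)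
  rcases IsPreconnected.subset_or_subset h1 h2 hd hsub h with h' | h'
  · exact Set.disjoint_left.1 hd (h' hy) hy1
  · exact Set.disjoint_left.1 hd hx1 (h' hx)

theorem no_circle (S : Set (Dend N)) : IsEmpty (S ≃ₜ Circle) := by
  refine ⟨fun e => ?_⟩
  have hne : (e.symm 1 : Dend N) ≠ e.symm (-1) := by
    intro h
    have h1 := e.symm.injective (Subtype.ext h)
    have h2 := congrArg (fun z : Circle => (z : ℂ)) h1
    simp only [Circle.coe_one] at h2
    have h3 := congrArg Complex.re h2
    norm_num at h3
  obtain ⟨v, O1, O2, h1, h2, h3, h4, h5, h6⟩ := sep_of_ne hne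
  have hF : Continuous (fun z : Circle => (e.symm z : Dend N)) :=
    continuous_subtype_val.comp e.symm.continuous
  have key : ∀ T : Set Circle, IsPreconnected T → (1 : Circle) ∈ T → (-1 : Circle) ∈ T →
      ∃ z ∈ T, (e.symm z : Dend N) = pw v := by
    intro T hT m1 m2
    have := pw_mem_of_conn (hT.image _ hF.continuousOn) ⟨1, m1, rfl⟩ ⟨-1, m2, rfl⟩ h1 h2 h3 h4 h5 h6
    exact this
  obtain ⟨z, -, hz⟩ := key Set.univ isPreconnected_univ trivial trivial
  have hz1 : (1 : Circle) ≠ z := by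
    rintro rfl
    have : pw v ∈ O1 ∪ O2 := Or.inl (hz ▸ h4)
    rw [h6] at this; exact this rfl
  have hz2 : (-1 : Circle) ≠ z := by
    rintro rfl
    have : pw v ∈ O1 ∪ O2 := Or.inr (hz ▸ h5)
    rw [h6] at this; exact this rfl
  obtain ⟨z', hz', h'⟩ := key {z}ᶜ (Circle.isPathConnected_compl_singleton z).isConnected.isPreconnected
    hz1 hz2
  exact hz' (e.symm.injective (Subtype.ext (h'.trans hz.symm)))

theorem arc_branch (A : Set (Dend N)) (h : Nonempty (A ≃ₜ unitInterval)) : ∃ v, pw v ∈ A := by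
  obtain ⟨e⟩ := h
  have hne : (e.symm 0 : Dend N) ≠ e.symm 1 := by
    intro h
    have h1 := e.symm.injective (Subtype.ext h)
    exact zero_ne_one h1
  obtain ⟨v, O1, O2, h1, h2, h3, h4, h5, h6⟩ := sep_of_ne hne
  have hA : IsPreconnected A := by
    have : A = Set.range (fun z : unitInterval => (e.symm z : Dend N)) := by
      ext x
      constructor
      · intro hx; exact ⟨e ⟨x, hx⟩, by simp⟩
      · rintro ⟨z, rfl⟩; exact (e.symm z).2
    rw [this]
    exact isPreconnected_range (continuous_subtype_val.comp e.symm.continuous)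
  exact ⟨v, pw_mem_of_conn hA (e.symm 0).2 (e.symm 1).2 h1 h2 h3 h4 h5 h6⟩

end Waz

open Topology

namespace Waz
set_option linter.unusedSimpArgs false
set_option linter.unusedSectionVars false

variable {N : ℕ}

/-! ### Orders of points -/

/-- Union of the first level cells satisfying `P`. -/
def cells (P : L N → Prop) : Set (Dend N) := {x | ∃ j y, P j ∧ f j y = x}

theorem conn_range_f (j : L N) : IsPreconnected (Set.range (f j)) := isPreconnected_range (cont_f j)

theorem conn_cells (P : L N → Prop) : IsPreconnected (cells P) := by
  have : cells P = ⋃₀ {s | ∃ j, P j ∧ s = Set.range (f j)} := by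
    ext x
    constructor
    · rintro ⟨j, y, h, rfl⟩; exact ⟨_, ⟨j, h, rfl⟩, y, rfl⟩
    · rintro ⟨_, ⟨j, h, rfl⟩, y, rfl⟩; exact ⟨j, y, h, rfl⟩
  rw [this]
  refine isPreconnected_sUnion p _ ?_ ?_
  · rintro _ ⟨j, -, rfl⟩; exact ⟨a, f_a j⟩
  · rintro _ ⟨j, -, rfl⟩; exact conn_range_f j

theorem conn_b' (m : ℕ) : ∀ s : K N, s m ≠ 1 →
    ∃ t : Set (Dend N), IsPreconnected t ∧ b ∉ t ∧ a ∈ t ∧ q s ∈ t := by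
  have h0 : ∀ s : K N, s 0 ≠ 1 →
      ∃ t : Set (Dend N), IsPreconnected t ∧ b ∉ t ∧ a ∈ t ∧ q s ∈ t := by
    intro s hs
    refine ⟨cells (· ≠ 1), conn_cells _, ?_, ⟨0, b, l01, f_0_b⟩, ⟨s 0, q (tl s), hs, (q_eq_f s).symm⟩⟩
    rintro ⟨j, y, hj, h⟩
    exact hj (f_eq_b.1 h).1
  induction m with
  | zero => exact h0
  | succ m ih =>
    intro s hs
    by_cases h1 : s 0 = 1
    · obtain ⟨t, t1, t2, t3, t4⟩ := ih (tl s) hs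
      refine ⟨f 1 '' t ∪ cells (· ≠ 1), ?_, ?_, Or.inr ⟨0, b, l01, f_0_b⟩,
        Or.inl ⟨_, t4, by rw [q_eq_f s, h1]⟩⟩
      · exact IsPreconnected.union p ⟨a, t3, f_a 1⟩ ⟨0, a, l01, f_a 0⟩
          (t1.image _ (cont_f 1).continuousOn) (conn_cells _)
      · rintro (⟨y, hy, h⟩ | ⟨j, y, hj, h⟩)
        · exact t2 ((f_eq_b.1 h).2 ▸ hy)
        · exact hj (f_eq_b.1 h).1
    · exact h0 s h1

theorem conn_compl_b : IsPreconnected ({b}ᶜ : Set (Dend N)) := by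
  refine isPreconnected_of_forall a fun z hz => ?_
  obtain ⟨s, rfl⟩ := q_surj z
  obtain ⟨m, hm⟩ := exists_ne_one hz
  obtain ⟨t, t1, t2, t3, t4⟩ := conn_b' m s hm
  exact ⟨t, fun z hz h => t2 (h ▸ hz), t3, t4, t1⟩

theorem image_compl_sing (h : Dend N ≃ₜ Dend N) (x : Dend N) : h '' {x}ᶜ = {h x}ᶜ := by
  rw [Set.image_compl_eq h.bijective, Set.image_singleton]

theorem conn_compl_a : IsPreconnected ({a}ᶜ : Set (Dend N)) := by
  have := conn_compl_b (N := N).image sg sg.continuous.continuousOn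
  rwa [image_compl_sing, sg_b] at this

theorem conn_U (i : L N) : IsPreconnected (U i) := conn_compl_a.image _ (cont_f i).continuousOn

theorem U_ne (i : L N) : (U i).Nonempty := ⟨_, f_mem_U.2 ⟨rfl, b_ne_a⟩⟩

theorem U_inj : Function.Injective (U : L N → Set (Dend N)) := by
  intro i j h
  by_contra hij
  obtain ⟨x, hx⟩ := U_ne i
  exact Set.disjoint_left.1 (U_disj hij) hx (h ▸ hx)

theorem U_sub (i : L N) : U i ⊆ ({p}ᶜ : Set (Dend N)) := by
  rw [← iUnion_U]; exact Set.subset_iUnion U i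

theorem conn_sub_U {C : Set (Dend N)} (hC : IsPreconnected C) (hp : p ∉ C) {i : L N} {x : Dend N}
    (hx : x ∈ C) (hi : x ∈ U i) : C ⊆ U i := by
  refine IsPreconnected.subset_left_of_subset_union (isOpen_U i)
    (v := ⋃ k ∈ {k : L N | k ≠ i}, U k) (isOpen_biUnion fun k _ => isOpen_U k) ?_ ?_ ⟨x, hx, hi⟩ hC
  · rw [Set.disjoint_iUnion₂_right]
    intro k hk; exact U_disj (Ne.symm hk)
  · intro z hz
    have hz' : z ∈ (⋃ i, U i) := by
      rw [iUnion_U]; intro h; exact hp (h ▸ hz)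
    obtain ⟨k, hk⟩ := Set.mem_iUnion.1 hz'
    by_cases h : k = i
    · exact Or.inl (h ▸ hk)
    · exact Or.inr (Set.mem_biUnion (x := k) h hk)

theorem comp_U {i : L N} {x : Dend N} (hx : x ∈ U i) : connectedComponentIn {p}ᶜ x = U i := by
  refine Set.Subset.antisymm ?_ ((conn_U i).subset_connectedComponentIn hx (U_sub i))
  refine conn_sub_U isPreconnected_connectedComponentIn ?_ (mem_connectedComponentIn (U_sub i hx)) hx
  intro h
  exact connectedComponentIn_subset _ _ h rfl

theorem setComp_p : setComponents (Dend N) {p}ᶜ = Set.range U := by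
  ext C
  constructor
  · rintro ⟨x, hx, rfl⟩
    rw [← iUnion_U] at hx
    obtain ⟨i, hi⟩ := Set.mem_iUnion.1 hx
    exact ⟨i, (comp_U hi).symm⟩
  · rintro ⟨i, rfl⟩
    obtain ⟨x, hx⟩ := U_ne i
    exact ⟨x, U_sub i hx, (comp_U hx).symm⟩

theorem ord_p : ptOrder (Dend N) p = N + 4 := by
  rw [ptOrder, setComp_p, ← Set.image_univ, Set.ncard_image_of_injective _ U_inj, Set.ncard_univ,
    Nat.card_eq_fintype_card, Fintype.card_fin]

theorem ord_homeo (h : Dend N ≃ₜ Dend N) (x : Dend N) : ptOrder (Dend N) (h x) = ptOrder (Dend N) x := by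
  have : setComponents (Dend N) {h x}ᶜ = (fun s => h '' s) '' setComponents (Dend N) {x}ᶜ := by
    rw [← image_compl_sing]
    ext C
    constructor
    · rintro ⟨_, ⟨y, hy, rfl⟩, rfl⟩
      exact ⟨_, ⟨y, hy, rfl⟩, Homeomorph.image_connectedComponentIn h hy⟩
    · rintro ⟨_, ⟨y, hy, rfl⟩, rfl⟩
      exact ⟨h y, ⟨y, hy, rfl⟩, Homeomorph.image_connectedComponentIn h hy⟩
  rw [ptOrder, this, Set.ncard_image_of_injective _ (Set.image_injective.2 h.injective)]
  rfl

/-! ### Reduction of branch points -/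

/-- The action of `sg` on words. -/
def sgw : List (L N) → List (L N)
  | [] => []
  | i :: w => Equiv.swap 0 1 i :: w

theorem sg_pw (w : List (L N)) : sg (pw w) = pw (sgw w) := by
  cases w with
  | nil => exact sg_p
  | cons i w => rw [pw_cons, sg, perm_f]; rfl

theorem sgw_length (w : List (L N)) : (sgw w).length = w.length := by
  cases w <;> rfl

theorem sgw_bin {w : List (L N)} (h : ∀ i ∈ w, i = 0 ∨ i = 1) : ∀ i ∈ sgw w, i = 0 ∨ i = 1 := by
  cases w with
  | nil => exact h
  | cons i w =>
    intro j hj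
    rcases List.mem_cons.1 hj with rfl | hj
    · rcases h i (by simp) with rfl | rfl
      · right; simp
      · left; simp
    · exact h j (by simp [hj])

theorem g_p : g (p : Dend N) = f 1 p := by
  conv_lhs => rw [← f_a 1, g_1, f_a]
theorem gi_1p : g⁻¹ (f 1 (p : Dend N)) = p := inv_eq_iff.2 g_p.symm
theorem g_0p : g (f 0 (p : Dend N)) = p := by
  rw [← f_a 1, g_01, f_a, f_a]

section red
variable {G : Subgroup (Dend N ≃ₜ Dend N)}

/-- Words allowed in the reduction. -/
def Okw (G : Subgroup (Dend N ≃ₜ Dend N)) (w : List (L N)) : Prop :=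
  (∀ π : Equiv.Perm (L N), π 0 = 0 → perm π ∈ G) ∨ ∀ i ∈ w, i = 0 ∨ i = 1

theorem Okw.sgw {w : List (L N)} (h : Okw G w) : Okw G (Waz.sgw w) := h.imp id sgw_bin
theorem Okw.tail {i : L N} {w : List (L N)} (h : Okw G (i :: w)) : Okw G w :=
  h.imp id fun h j hj => h j (by simp [hj])
theorem Okw.cons0 {w : List (L N)} (h : Okw G w) : Okw G (0 :: w) :=
  h.imp id fun h j hj => by
    rcases List.mem_cons.1 hj with rfl | hj
    · exact Or.inl rfl
    · exact h j hj
theorem Okw.cons1 {w : List (L N)} (h : Okw G w) : Okw G (1 :: w) :=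
  h.imp id fun h j hj => by
    rcases List.mem_cons.1 hj with rfl | hj
    · exact Or.inr rfl
    · exact h j hj
theorem red1 (hg : g ∈ G) (hs : s1g ∈ G) (w : List (L N)) (h : Okw G w) :
    ∃ e ∈ G, ∃ w' : List (L N), Okw G w' ∧ w'.length < (1 :: w).length ∧ e (pw (1 :: w)) = pw w' := by
  have hgi := G.inv_mem hg
  cases w with
  | nil => exact ⟨_, hgi, [], h, by simp, gi_1p⟩
  | cons i w =>
    by_cases h0 : i = 0
    · subst h0
      cases w with
      | nil =>
        refine ⟨s1g, hs, [1], h.tail.cons1, by simp, ?_⟩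
        simp only [pw_cons, pw_nil, s1g, sup_self, g_0p]
      | cons j w =>
        by_cases j0 : j = 0
        · subst j0
          refine ⟨g⁻¹ * s1g, G.mul_mem hgi hs, 1 :: 0 :: sgw w, h.tail.tail.sgw.cons0.cons1,
            by simp [sgw_length], ?_⟩
          simp only [pw_cons, mul_ap, s1g, sup_self, g_00, gi_11, sg_pw]
        · by_cases j1 : j = 1
          · subst j1
            refine ⟨s1g, hs, 1 :: 0 :: w, h.tail.tail.cons0.cons1, by simp, ?_⟩
            simp only [pw_cons, s1g, sup_self, g_01]
          · refine ⟨s1g, hs, 1 :: j :: w, h.tail.cons1, by simp, ?_⟩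
            simp only [pw_cons, s1g, sup_self, g_0i j0 j1]
    · by_cases h1 : i = 1
      · subst h1
        exact ⟨_, hgi, 1 :: w, h, by simp, by simp only [pw_cons, gi_11]⟩
      · exact ⟨_, hgi, i :: w, h, by simp, by simp only [pw_cons, gi_1i h0 h1]⟩

theorem red (hg : g ∈ G) (hs : s1g ∈ G) (w : List (L N)) (h : Okw G w) (hw : w ≠ []) :
    ∃ e ∈ G, ∃ w' : List (L N), Okw G w' ∧ w'.length < w.length ∧ e (pw w) = pw w' := by
  cases w with
  | nil => exact absurd rfl hw
  | cons i w =>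
    by_cases h1 : i = 1
    · subst h1; exact red1 hg hs w h.tail
    by_cases h0 : i = 0
    · subst h0
      cases w with
      | nil => exact ⟨g, hg, [], h.tail, by simp, g_0p⟩
      | cons j w =>
        by_cases j0 : j = 0
        · subst j0
          obtain ⟨e, he, w', h1, h2, h3⟩ := red1 hg hs (0 :: sgw w) h.tail.tail.sgw.cons0
          refine ⟨e * g, G.mul_mem he hg, w', h1, by simpa [sgw_length] using h2, ?_⟩
          rw [← h3]
          simp only [pw_cons, mul_ap, g_00, sg_pw]
        · by_cases j1 : j = 1
          · subst j1
            exact ⟨g, hg, 0 :: w, h.tail.tail.cons0, by simp, by simp only [pw_cons, g_01]⟩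
          · exact ⟨g, hg, j :: w, h.tail, by simp, by simp only [pw_cons, g_0i j0 j1]⟩
    · have hp : ∀ π : Equiv.Perm (L N), π 0 = 0 → perm π ∈ G := by
        rcases h with h | h
        · exact h
        · rcases h i (by simp) with h | h
          · exact absurd h h0
          · exact absurd h h1
      obtain ⟨e, he, w', h1', h2, h3⟩ := red1 hg hs w h.tail
      refine ⟨e * perm (Equiv.swap 1 i), G.mul_mem he (hp _ ?_), w', h1', by simpa using h2, ?_⟩
      · exact Equiv.swap_apply_of_ne_of_ne l01 (Ne.symm h0)
      · rw [← h3, mul_ap, pw_cons, perm_f, Equiv.swap_apply_right, pw_cons]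

theorem red_all (hg : g ∈ G) (hs : s1g ∈ G) (m : ℕ) : ∀ w : List (L N), w.length ≤ m → Okw G w → ∃ e ∈ G, e (pw w) = p := by
  induction m with
  | zero =>
    intro w hw _
    rw [List.length_eq_zero_iff.1 (Nat.le_zero.1 hw)]
    exact ⟨1, G.one_mem, rfl⟩
  | succ m ih =>
    intro w hw h
    by_cases hw0 : w = []
    · rw [hw0]; exact ⟨1, G.one_mem, rfl⟩
    · obtain ⟨e, he, w', h1, h2, h3⟩ := red hg hs w h hw0
      obtain ⟨e', he', h'⟩ := ih w' (by omega) h1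
      exact ⟨e' * e, G.mul_mem he' he, by rw [mul_ap, h3, h']⟩

theorem red_pw (hg : g ∈ G) (hs : s1g ∈ G) (w : List (L N)) (h : Okw G w) : ∃ e ∈ G, e (pw w) = p :=
  red_all hg hs w.length w le_rfl h
end red

theorem ord_pw (w : List (L N)) : ptOrder (Dend N) (pw w) = N + 4 := by
  obtain ⟨e, -, he⟩ := red_pw (G := ⊤) (Subgroup.mem_top _) (Subgroup.mem_top _) w
    (Or.inl fun _ _ => Subgroup.mem_top _)
  rw [← ord_homeo e, he, ord_p]

/-! ### Other points -/

theorem chain {x : Dend N} (hx : ∀ v, x ≠ pw v) (m : ℕ) : ∃ (w : List (L N)) (y : Dend N)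
    (A B : Set (Dend N)), w.length = m ∧ x = fw w y ∧ IsPreconnected A ∧ IsPreconnected B ∧ x ∉ A ∧ x ∉ B ∧
    (Set.range (fw w))ᶜ ⊆ A ∪ B ∧ (A = ∅ ∨ fw w a ∈ A) ∧ (B = ∅ ∨ fw w b ∈ B) := by
  induction m with
  | zero =>
    refine ⟨[], x, ∅, ∅, rfl, rfl, isPreconnected_empty, isPreconnected_empty, id, id, ?_, Or.inl rfl, Or.inl rfl⟩
    intro z hz; exact absurd ⟨z, rfl⟩ hz
  | succ m ih =>
    obtain ⟨w, y, A, B, hw, hxy, hA, hB, xA, xB, hc, ha, hb⟩ := ih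
    obtain ⟨i, y, rfl⟩ := cover y
    have hya : y ≠ a := by
      rintro rfl
      rw [f_a] at hxy
      exact hx w hxy
    let C : Set (Dend N) := fw w '' cells (· ≠ i)
    have hC : IsPreconnected C := (conn_cells _).image _ (cont_fw w).continuousOn
    have xC : x ∉ C := by
      rintro ⟨_, ⟨j, z, hj, rfl⟩, h⟩
      rw [hxy] at h
      exact hya ((f_eq_ne hj).1 (fw_inj w h)).2
    have fwa : fw (w ++ [i]) a = fw w p := by rw [fw_append]; simp [f_a]
    have fwb : fw (w ++ [i]) b = fw w (f i b) := by rw [fw_append]; simp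
    obtain ⟨j, hj⟩ : ∃ j : L N, j ≠ i := exists_ne i
    have pC : fw w p ∈ C := ⟨p, ⟨j, a, hj, f_a j⟩, rfl⟩
    have hcov : ∀ z, z ∉ Set.range (fw (w ++ [i])) → z ∈ A ∨ z ∈ B ∨ z ∈ C := by
      intro z hz
      by_cases hz' : z ∈ Set.range (fw w)
      · obtain ⟨z, rfl⟩ := hz'
        obtain ⟨k, z, rfl⟩ := cover z
        have hk : k ≠ i := by
          rintro rfl; exact hz ⟨z, by rw [fw_append]; simp⟩
        exact Or.inr (Or.inr ⟨_, ⟨k, z, hk, rfl⟩, rfl⟩)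
      · rcases hc hz' with h | h
        · exact Or.inl h
        · exact Or.inr (Or.inl h)
    have uni : ∀ (D : Set (Dend N)) (c : Dend N), IsPreconnected D → (D = ∅ ∨ c ∈ D) → c ∈ C →
        IsPreconnected (D ∪ C) := by
      intro D c hD h hcC
      rcases h with rfl | h
      · rwa [Set.empty_union]
      · exact IsPreconnected.union c h hcC hD hC
    by_cases i0 : i = 0
    · subst i0
      refine ⟨w ++ [0], y, B ∪ C, A, by simp [hw], by rw [hxy, fw_append]; simp, ?_, hA, ?_, xA, ?_,
        Or.inr (Or.inr (fwa ▸ pC)), ?_⟩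
      · exact uni B _ hB hb ⟨b, ⟨1, b, l10, f_1_b⟩, rfl⟩
      · rintro (h | h); exacts [xB h, xC h]
      · intro z hz; rcases hcov z hz with h | h | h
        exacts [Or.inr h, Or.inl (Or.inl h), Or.inl (Or.inr h)]
      · rwa [fwb, f_0_b]
    · have aC : fw w a ∈ C := ⟨a, ⟨0, b, Ne.symm i0, f_0_b⟩, rfl⟩
      by_cases i1 : i = 1
      · subst i1
        refine ⟨w ++ [1], y, A ∪ C, B, by simp [hw], by rw [hxy, fw_append]; simp, ?_, hB, ?_, xB, ?_,
          Or.inr (Or.inr (fwa ▸ pC)), ?_⟩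
        · exact uni A _ hA ha aC
        · rintro (h | h); exacts [xA h, xC h]
        · intro z hz; rcases hcov z hz with h | h | h
          exacts [Or.inl (Or.inl h), Or.inr h, Or.inl (Or.inr h)]
        · rwa [fwb, f_1_b]
      · have bC : fw w b ∈ C := ⟨b, ⟨1, b, Ne.symm i1, f_1_b⟩, rfl⟩
        refine ⟨w ++ [i], y, (A ∪ C) ∪ (B ∪ C), ∅, by simp [hw], by rw [hxy, fw_append]; simp, ?_,
          isPreconnected_empty, ?_, id, ?_, Or.inr (Or.inl (Or.inr (fwa ▸ pC))), Or.inl rfl⟩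
        · exact IsPreconnected.union _ (Or.inr pC) (Or.inr pC) (uni A _ hA ha aC) (uni B _ hB hb bC)
        · rintro ((h | h) | h | h); exacts [xA h, xC h, xB h, xC h]
        · intro z hz; rcases hcov z hz with h | h | h
          exacts [Or.inl (Or.inl (Or.inl h)), Or.inl (Or.inr (Or.inl h)), Or.inl (Or.inl (Or.inr h))]

theorem same_comp {x u v : Dend N} {A : Set (Dend N)} (hA : IsPreconnected A) (hx : x ∉ A) (hu : u ∈ A)
    (hv : v ∈ A) : connectedComponentIn {x}ᶜ u = connectedComponentIn {x}ᶜ v := by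
  refine connectedComponentIn_eq ?_
  refine hA.subset_connectedComponentIn hu ?_ hv
  rintro z hz rfl
  exact hx hz

theorem ord_other {x : Dend N} (hx : ∀ v, x ≠ pw v) : ptOrder (Dend N) x = 1 ∨ ptOrder (Dend N) x = 2 := by
  have hle : (setComponents (Dend N) {x}ᶜ).encard ≤ 2 := by
    by_contra hcon
    have h3 : (3 : ℕ∞) ≤ (setComponents (Dend N) {x}ᶜ).encard := by
      have := Order.add_one_le_of_lt (not_le.1 hcon)
      exact this
    obtain ⟨t, ht, hte⟩ := Set.exists_subset_encard_eq h3
    obtain ⟨C1, C2, C3, h12, h13, h23, rfl⟩ := Set.encard_eq_three.1 hte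
    obtain ⟨u1, hu1, rfl⟩ := ht (show C1 ∈ _ by simp)
    obtain ⟨u2, hu2, rfl⟩ := ht (show C2 ∈ _ by simp)
    obtain ⟨u3, hu3, rfl⟩ := ht (show C3 ∈ _ by simp)
    have hO : IsOpen (({u1, u2, u3} : Set (Dend N))ᶜ) :=
      (Set.toFinite _).isClosed.isOpen_compl
    have hxO : x ∈ (({u1, u2, u3} : Set (Dend N))ᶜ) := by
      simp only [Set.mem_compl_iff, Set.mem_insert_iff, Set.mem_singleton_iff, not_or]
      exact ⟨fun h => hu1 h.symm, fun h => hu2 h.symm, fun h => hu3 h.symm⟩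
    obtain ⟨m, hm⟩ := basic_nhd hxO hO
    obtain ⟨w, y, A, B, hw, hxy, hA, hB, xA, xB, hc, -, -⟩ := chain hx m
    have hsub := hm w hw ⟨y, hxy.symm⟩
    have m1 : u1 ∈ A ∪ B := hc fun h => hsub h (by simp)
    have m2 : u2 ∈ A ∪ B := hc fun h => hsub h (by simp)
    have m3 : u3 ∈ A ∪ B := hc fun h => hsub h (by simp)
    rcases m1 with m1 | m1 <;> rcases m2 with m2 | m2 <;> rcases m3 with m3 | m3
    · exact h12 (same_comp hA xA m1 m2)
    · exact h12 (same_comp hA xA m1 m2)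
    · exact h13 (same_comp hA xA m1 m3)
    · exact h23 (same_comp hB xB m2 m3)
    · exact h23 (same_comp hA xA m2 m3)
    · exact h13 (same_comp hB xB m1 m3)
    · exact h12 (same_comp hB xB m1 m2)
    · exact h12 (same_comp hB xB m1 m2)
  have hfin : (setComponents (Dend N) {x}ᶜ).Finite := Set.finite_of_encard_le_coe (k := 2) hle
  have hne : (setComponents (Dend N) {x}ᶜ).Nonempty := ⟨_, p, (hx []).symm, rfl⟩
  have h1 : 0 < ptOrder (Dend N) x := (Set.ncard_pos hfin).2 hne
  have h2 : ptOrder (Dend N) x ≤ 2 := by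
    have : ((setComponents (Dend N) {x}ᶜ).ncard : ℕ∞) ≤ 2 := by rwa [hfin.cast_ncard_eq]
    exact_mod_cast this
  omega

theorem wazewski : IsWazewskiDendrite (N + 4) (Dend N) := by
  refine ⟨⟨⟨a⟩, inferInstance, inferInstance, inferInstance, metr, no_circle⟩, ?_, ?_⟩
  · intro x
    by_cases h : ∃ v, x = pw v
    · obtain ⟨v, rfl⟩ := h; exact Or.inr (Or.inr (ord_pw v))
    · push_neg at h
      rcases ord_other h with h | h
      exacts [Or.inl h, Or.inr (Or.inl h)]
  · intro A hA
    obtain ⟨v, hv⟩ := arc_branch A hA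
    exact ⟨_, hv, ord_pw v⟩

theorem branch_homeo (h : Dend N ≃ₜ Dend N) : ∃ v, h p = pw v := by
  by_contra! hc
  have h1 := ord_other hc
  rw [ord_homeo, ord_p] at h1
  omega

end Waz

open Topology

namespace Waz
set_option linter.unusedSimpArgs false
set_option linter.unusedSectionVars false

variable {N : ℕ}

theorem kap_101 (x : Dend N) : kap (f 1 (f 0 (f 1 x))) = f 0 (f 0 (f 1 (sg x))) := by
  simp only [kap, mul_ap, kin, s0g, g_1, sup_self, gi_10, sg_1, g_00, g_01, sg_0]

/-! ### Supported copies -/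

/-- `e` is the copy of `h` under the embedding `c`. -/
def IsSup (c : Dend N → Dend N) (h e : Dend N ≃ₜ Dend N) : Prop :=
  (∀ x, e (c x) = c (h x)) ∧ ∀ y, y ∉ Set.range c → e y = y

theorem IsSup.one (c : Dend N → Dend N) : IsSup c 1 1 := ⟨fun _ => rfl, fun _ _ => rfl⟩

theorem IsSup.mul {c : Dend N → Dend N} {h h' e e' : Dend N ≃ₜ Dend N} (H : IsSup c h e)
    (H' : IsSup c h' e') : IsSup c (h * h') (e * e') := by
  refine ⟨fun x => ?_, fun y hy => ?_⟩
  · rw [mul_ap, H'.1, H.1, mul_ap]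
  · rw [mul_ap, H'.2 y hy, H.2 y hy]

theorem IsSup.inv {c : Dend N → Dend N} {h e : Dend N ≃ₜ Dend N} (H : IsSup c h e) :
    IsSup c h⁻¹ e⁻¹ := by
  refine ⟨fun x => ?_, fun y hy => ?_⟩
  · rw [inv_eq_iff, H.1, ap_inv]
  · rw [inv_eq_iff, H.2 y hy]

theorem IsSup.conj' {c c' : Dend N → Dend N} {h e t s : Dend N ≃ₜ Dend N} (H : IsSup c h e)
    (ht : ∀ x, t (c x) = c' (s x)) : IsSup c' (s * h * s⁻¹) (t * e * t⁻¹) := by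
  have ht' : ∀ x, t⁻¹ (c' x) = c (s⁻¹ x) := by
    intro x; rw [inv_eq_iff, ht, ap_inv]
  refine ⟨fun x => ?_, fun y hy => ?_⟩
  · simp only [mul_ap, ht', H.1, ht]
  · have : t⁻¹ y ∉ Set.range c := by
      rintro ⟨x, hx⟩
      apply hy
      refine ⟨s x, ?_⟩
      rw [← ht, hx, ap_inv]
    simp only [mul_ap, H.2 _ this, ap_inv]

theorem IsSup.conj {c c' : Dend N → Dend N} {h e t : Dend N ≃ₜ Dend N} (H : IsSup c h e)
    (ht : ∀ x, t (c x) = c' x) : IsSup c' h (t * e * t⁻¹) := by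
  have := H.conj' (s := 1) (t := t) (c' := c') (fun x => by rw [ht, one_ap])
  rwa [one_mul, inv_one, mul_one] at this

theorem IsSup.nest {c d : Dend N → Dend N} {h h' e : Dend N ≃ₜ Dend N} (H : IsSup c h e)
    (H' : IsSup d h' h) : IsSup (c ∘ d) h' e := by
  refine ⟨fun x => ?_, fun y hy => ?_⟩
  · simp only [Function.comp, H.1, H'.1]
  · by_cases hc : y ∈ Set.range c
    · obtain ⟨x, rfl⟩ := hc
      rw [H.1, H'.2 x]
      rintro ⟨z, rfl⟩; exact hy ⟨z, rfl⟩
    · exact H.2 y hc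

theorem IsSup.unnest {c d : Dend N → Dend N} (hc : Function.Injective c) {h h' e : Dend N ≃ₜ Dend N}
    (H : IsSup (c ∘ d) h e) (H' : IsSup d h h') : IsSup c h' e := by
  refine ⟨fun x => ?_, fun y hy => ?_⟩
  · by_cases hx : x ∈ Set.range d
    · obtain ⟨z, rfl⟩ := hx
      rw [H'.1]; exact H.1 z
    · rw [H'.2 x hx, H.2]
      rintro ⟨z, hz⟩; exact hx ⟨z, hc hz⟩
  · apply H.2
    rintro ⟨z, rfl⟩; exact hy ⟨d z, rfl⟩

theorem isSup_sup (i : L N) (h : Dend N ≃ₜ Dend N) (ha : h a = a) : IsSup (f i) h (sup i h ha) := by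
  refine ⟨fun x => sup_self x, fun y hy => ?_⟩
  obtain ⟨j, y, rfl⟩ := cover y
  exact sup_ne (by rintro rfl; exact hy ⟨y, rfl⟩) y

/-! ### The group -/

/-- Generators. -/
inductive IsGen : (Dend N ≃ₜ Dend N) → Prop
  | tr (i j : L N) (h : Equiv.swap i j 0 = 0 ∨ Equiv.swap i j 1 = 1) : IsGen (perm (Equiv.swap i j))
  | kap : IsGen kap
  | sp (π : Equiv.Perm (L N)) (h : π 0 = 0) : IsGen (sup 2 (perm π) (perm_a h))
  | sg : IsGen (sup 2 g g_a)
  | ss : IsGen (sup 2 s0g s0g_a)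

/-- The group generated by the generators. -/
def E (N : ℕ) : Subgroup (Dend N ≃ₜ Dend N) := Subgroup.closure {e | IsGen e}

theorem gen_mem {e : Dend N ≃ₜ Dend N} (h : IsGen e) : e ∈ E N := Subgroup.subset_closure h

noncomputable def permHom (N : ℕ) : Equiv.Perm (L N) →* (Dend N ≃ₜ Dend N) where
  toFun := perm
  map_one' := perm_one
  map_mul' := perm_mul

theorem swap_mem (i j : L N) : perm (Equiv.swap i j) ∈ E N := by
  have s02 : perm (Equiv.swap (0 : L N) 2) ∈ E N :=
    gen_mem (IsGen.tr _ _ (Or.inr (Equiv.swap_apply_of_ne_of_ne l10 l12)))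
  have s12 : perm (Equiv.swap (1 : L N) 2) ∈ E N :=
    gen_mem (IsGen.tr _ _ (Or.inl (Equiv.swap_apply_of_ne_of_ne l01 l02)))
  have s01 : perm (Equiv.swap (0 : L N) 1) ∈ E N := by
    have : Equiv.swap (0 : L N) 1 = Equiv.swap 2 0 * Equiv.swap 1 2 * Equiv.swap 2 0 := by
      rw [← Equiv.swap_mul_swap_mul_swap l12 l10, Equiv.swap_comm]
    rw [this, perm_mul, perm_mul, Equiv.swap_comm 2 0]
    exact mul_mem (mul_mem s02 s12) s02
  by_cases h0 : Equiv.swap i j 0 = 0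
  · exact gen_mem (IsGen.tr _ _ (Or.inl h0))
  by_cases h1 : Equiv.swap i j 1 = 1
  · exact gen_mem (IsGen.tr _ _ (Or.inr h1))
  have m0 : 0 = i ∨ 0 = j := by
    by_contra! h; exact h0 (Equiv.swap_apply_of_ne_of_ne h.1 h.2)
  have m1 : 1 = i ∨ 1 = j := by
    by_contra! h; exact h1 (Equiv.swap_apply_of_ne_of_ne h.1 h.2)
  rcases m0 with m0 | m0 <;> rcases m1 with m1 | m1
  · exact absurd (m1.trans m0.symm) l10
  · rw [← m0, ← m1]; exact s01
  · rw [← m0, ← m1, Equiv.swap_comm]; exact s01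
  · exact absurd (m1.trans m0.symm) l10

theorem perm_mem (π : Equiv.Perm (L N)) : perm π ∈ E N := by
  have h : (⊤ : Subgroup (Equiv.Perm (L N))) ≤ (E N).comap (permHom N) := by
    rw [← Equiv.Perm.closure_isSwap, Subgroup.closure_le]
    rintro _ ⟨i, j, -, rfl⟩
    exact swap_mem i j
  exact h (Subgroup.mem_top π)

theorem kap_mem : kap ∈ E N := gen_mem IsGen.kap

/-- `h` can be realised on a half-tree. -/
def Gam (N : ℕ) : Subgroup (Dend N ≃ₜ Dend N) where
  carrier := {h | h a = a ∧ ∃ e ∈ E N, IsSup (f 2) h e}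
  one_mem' := ⟨rfl, 1, one_mem _, IsSup.one _⟩
  mul_mem' := by
    rintro h h' ⟨h1, e, he, H⟩ ⟨h1', e', he', H'⟩
    exact ⟨by rw [mul_ap, h1', h1], _, mul_mem he he', H.mul H'⟩
  inv_mem' := by
    rintro h ⟨h1, e, he, H⟩
    exact ⟨by rw [inv_eq_iff, h1], _, inv_mem he, H.inv⟩

/-- `h` can be realised on an interval-like cell. -/
def Del (N : ℕ) : Subgroup (Dend N ≃ₜ Dend N) where
  carrier := {h | h a = a ∧ h b = b ∧ ∃ e ∈ E N, IsSup (f 2 ∘ f 0) h e}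
  one_mem' := ⟨rfl, rfl, 1, one_mem _, IsSup.one _⟩
  mul_mem' := by
    rintro h h' ⟨h1, h2, e, he, H⟩ ⟨h1', h2', e', he', H'⟩
    exact ⟨by rw [mul_ap, h1', h1], by rw [mul_ap, h2', h2], _, mul_mem he he', H.mul H'⟩
  inv_mem' := by
    rintro h ⟨h1, h2, e, he, H⟩
    exact ⟨by rw [inv_eq_iff, h1], by rw [inv_eq_iff, h2], _, inv_mem he, H.inv⟩

theorem Gam_perm {π : Equiv.Perm (L N)} (h : π 0 = 0) : perm π ∈ Gam N :=
  ⟨perm_a h, _, gen_mem (IsGen.sp π h), isSup_sup _ _ _⟩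
theorem Gam_g : g ∈ Gam N := ⟨g_a, _, gen_mem IsGen.sg, isSup_sup _ _ _⟩
theorem Gam_s0g : s0g ∈ Gam N := ⟨s0g_a, _, gen_mem IsGen.ss, isSup_sup _ _ _⟩
theorem Gam_a {h : Dend N ≃ₜ Dend N} (H : h ∈ Gam N) : h a = a := H.1
theorem Del_a {h : Dend N ≃ₜ Dend N} (H : h ∈ Del N) : h a = a := H.1
theorem Del_b {h : Dend N ≃ₜ Dend N} (H : h ∈ Del N) : h b = b := H.2.1

/-- Half-tree embeddings. -/
def HT (c : Dend N → Dend N) : Prop := ∀ h ∈ Gam N, ∃ e ∈ E N, IsSup c h e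
/-- Interval embeddings. -/
def IT (c : Dend N → Dend N) : Prop := ∀ h ∈ Del N, ∃ e ∈ E N, IsSup c h e

theorem HT_of_map {c : Dend N → Dend N} {t : Dend N ≃ₜ Dend N} (ht : t ∈ E N)
    (h : ∀ x, t (f 2 x) = c x) : HT c := by
  rintro k ⟨-, e, he, H⟩
  exact ⟨_, mul_mem (mul_mem ht he) (inv_mem ht), H.conj h⟩

theorem HT_f (i : L N) : HT (f i) :=
  HT_of_map (perm_mem (Equiv.swap 2 i)) fun x => by rw [perm_f, Equiv.swap_apply_left]

theorem mem_sup (i : L N) {h : Dend N ≃ₜ Dend N} (H : h ∈ Gam N) : sup i h H.1 ∈ E N := by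
  obtain ⟨e, he, H'⟩ := HT_f i h H
  have : sup i h H.1 = e := homeo_ext fun x => by
    by_cases hx : x ∈ Set.range (f i)
    · obtain ⟨y, rfl⟩ := hx; rw [sup_self, H'.1]
    · rw [H'.2 x hx, (isSup_sup i h H.1).2 x hx]
  rw [this]; exact he

theorem om_mem {i : L N} (hi : i ≠ 0) : ∃ e ∈ E N, ∀ x, e (f 2 x) = f 2 (f i x) := by
  have hs : Equiv.swap (2 : L N) i 0 = 0 := Equiv.swap_apply_of_ne_of_ne l02 hi.symm
  refine ⟨sup 2 (perm (Equiv.swap 2 i)) (perm_a hs) * perm (Equiv.swap 0 2) * sup 0 g g_a * kap,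
    mul_mem (mul_mem (mul_mem (gen_mem (IsGen.sp _ hs)) (perm_mem _)) (mem_sup 0 Gam_g)) kap_mem, fun x => ?_⟩
  simp only [mul_ap, kap_i l20 l21, sup_self, g_0i l20 l21, perm_f, Equiv.swap_apply_left]

theorem Gam_sup {i : L N} (hi : i ≠ 0) {h : Dend N ≃ₜ Dend N} (H : h ∈ Gam N) :
    sup i h H.1 ∈ Gam N := by
  obtain ⟨t, ht, h1⟩ := om_mem hi
  obtain ⟨ha, e, he, H'⟩ := H
  refine ⟨sup_a (Or.inl hi), _, mul_mem (mul_mem ht he) (inv_mem ht), ?_⟩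
  exact IsSup.unnest (f_inj 2) (H'.conj (c' := f 2 ∘ f i) h1) (isSup_sup i h ha)

theorem Gam_sup0 {h : Dend N ≃ₜ Dend N} (H : h ∈ Del N) : sup 0 h H.1 ∈ Gam N := by
  obtain ⟨ha, hb, e, he, H'⟩ := H
  exact ⟨sup_a (Or.inr hb), e, he, IsSup.unnest (f_inj 2) H' (isSup_sup 0 h ha)⟩

theorem Gam_s1g : s1g ∈ Gam N := Gam_sup l10 Gam_g

theorem Del_of_sup0 {h h' : Dend N ≃ₜ Dend N} (ha : h a = a) (hb : h b = b) (H : h' ∈ Gam N)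
    (hs : IsSup (f 0) h h') : h ∈ Del N := by
  obtain ⟨-, e, he, H'⟩ := H
  exact ⟨ha, hb, e, he, H'.nest hs⟩

theorem Del_g : g ∈ Del N := Del_of_sup0 g_a g_b Gam_s0g (isSup_sup 0 g g_a)

theorem Del_perm {π : Equiv.Perm (L N)} (h0 : π 0 = 0) (h1 : π 1 = 1) : perm π ∈ Del N := by
  have key : g⁻¹ * perm π * g = sup 0 (perm π) (perm_a h0) := by
    refine homeo_ext <| cells_ext fun i x => ?_
    by_cases i0 : i = 0
    · subst i0
      rw [sup_self]
      refine cells_ext (F := fun x => (g⁻¹ * perm π * g : Dend N ≃ₜ Dend N) (f 0 x)) (G := fun x => f 0 (perm π x)) ?_ x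
      intro j y
      by_cases j0 : j = 0
      · subst j0; simp only [mul_ap, g_00, perm_f, h1, h0, gi_10, sg_sg]
      · by_cases j1 : j = 1
        · subst j1; simp only [mul_ap, g_01, perm_f, h1, h0, gi_0]
        · have k0 : π j ≠ 0 := fun h => j0 (π.injective (h.trans h0.symm))
          have k1 : π j ≠ 1 := fun h => j1 (π.injective (h.trans h1.symm))
          simp only [mul_ap, g_0i j0 j1, perm_f, gi_i k0 k1]
    · rw [sup_ne i0]
      by_cases i1 : i = 1
      · subst i1; simp only [mul_ap, g_1, perm_f, h1, gi_11]
      · simp only [mul_ap, g_i i0 i1, perm_f, h1, gi_1i i0 i1]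
  refine Del_of_sup0 (perm_a h0) (perm_b h1) ?_ (isSup_sup 0 _ (perm_a h0))
  rw [← key]
  exact mul_mem (mul_mem (inv_mem Gam_g) (Gam_perm h0)) Gam_g

theorem flip_mem : ∃ t ∈ E N, ∀ x, t (f 2 (f 0 x)) = f 2 (f 0 (sg x)) := by
  let u := perm (Equiv.swap (1 : L N) 2)
  let t : Dend N ≃ₜ Dend N := sup 1 g g_a * sg * kap * (sup 1 g g_a)⁻¹
  have hu : u ∈ E N := perm_mem _
  have hs := mem_sup (N := N) 1 Gam_g
  have ht : t ∈ E N := mul_mem (mul_mem (mul_mem hs (perm_mem _)) kap_mem) (inv_mem hs)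
  have hi : ∀ x : Dend N, (sup 1 g g_a)⁻¹ (f 1 (f 0 x)) = f 1 (f 0 (f 1 x)) := by
    intro x; rw [inv_eq_iff, sup_self, g_01]
  refine ⟨u * t * u⁻¹, mul_mem (mul_mem hu ht) (inv_mem hu), fun x => ?_⟩
  have hu1 : ∀ x, u (f 1 x) = f 2 x := by
    intro x; simp only [u, perm_f, Equiv.swap_apply_left]
  have hu2 : ∀ x, u⁻¹ (f 2 x) = f 1 x := by
    intro x; rw [inv_eq_iff, hu1]
  simp only [mul_ap, hu2, t, hi, kap_101, sg_0, sup_self, g_01, hu1]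

theorem Del_flip {h : Dend N ≃ₜ Dend N} (H : h ∈ Del N) : sg * h * sg⁻¹ ∈ Del N := by
  obtain ⟨t, ht, h1⟩ := flip_mem (N := N)
  obtain ⟨ha, hb, e, he, H'⟩ := H
  refine ⟨by simp only [mul_ap, sg_inv, sg_a, hb, sg_b], by simp only [mul_ap, sg_inv, sg_a, ha, sg_b], _,
    mul_mem (mul_mem ht he) (inv_mem ht), H'.conj' (c' := f 2 ∘ f 0) h1⟩

theorem Del_sup1 {h : Dend N ≃ₜ Dend N} (H : h ∈ Del N) : sup 1 h H.1 ∈ Del N := by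
  obtain ⟨ha, hb, e, he, H'⟩ := H
  have ht : (sup 2 g g_a)⁻¹ ∈ E N := inv_mem (mem_sup 2 Gam_g)
  have h1 : ∀ x : Dend N, (sup 2 g g_a)⁻¹ ((f 2 ∘ f 0) x) = ((f 2 ∘ f 0) ∘ f 1) x := by
    intro x; simp only [Function.comp]; rw [inv_eq_iff, sup_self, g_01]
  refine ⟨sup_a (Or.inr hb), sup_b (Or.inr hb), _, mul_mem (mul_mem ht he) (inv_mem ht), ?_⟩
  exact IsSup.unnest ((f_inj 2).comp (f_inj 0)) (H'.conj h1) (isSup_sup 1 h ha)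

theorem Del_sup0 {h : Dend N ≃ₜ Dend N} (H : h ∈ Del N) : sup 0 h H.1 ∈ Del N := by
  have hH := H
  obtain ⟨ha, hb, -⟩ := hH
  obtain ⟨-, -, e, he, H'⟩ := Del_flip H
  obtain ⟨t, ht, h2⟩ := om_mem (l10 (N := N))
  have ht' : (sup 2 g g_a)⁻¹ * t ∈ E N := mul_mem (inv_mem (mem_sup 2 Gam_g)) ht
  have h1 : ∀ x : Dend N, ((sup 2 g g_a)⁻¹ * t : Dend N ≃ₜ Dend N) ((f 2 ∘ f 0) x) = ((f 2 ∘ f 0) ∘ f 0) (sg x) := by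
    intro x; simp only [Function.comp, mul_ap, h2]; rw [inv_eq_iff, sup_self, g_00, sg_sg]
  have h3 := H'.conj' h1
  have h4 : sg * (sg * h * sg⁻¹) * sg⁻¹ = h := homeo_ext fun x => by
    simp only [mul_ap, sg_inv, sg_sg]
  rw [h4] at h3
  refine ⟨sup_a (Or.inr hb), sup_b (Or.inr hb), _, mul_mem (mul_mem ht' he) (inv_mem ht'), ?_⟩
  exact IsSup.unnest ((f_inj 2).comp (f_inj 0)) h3 (isSup_sup 0 h ha)

theorem Del_supi {i : L N} (h0 : i ≠ 0) (h1 : i ≠ 1) {h : Dend N ≃ₜ Dend N} (H : h ∈ Gam N) :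
    sup i h H.1 ∈ Del N := by
  obtain ⟨ha, e, he, H'⟩ := H
  obtain ⟨t, ht, h2⟩ := om_mem h0
  have ht' : (sup 2 g g_a)⁻¹ * t ∈ E N := mul_mem (inv_mem (mem_sup 2 Gam_g)) ht
  have h3 : ∀ x : Dend N, ((sup 2 g g_a)⁻¹ * t : Dend N ≃ₜ Dend N) (f 2 x) = ((f 2 ∘ f 0) ∘ f i) x := by
    intro x; simp only [Function.comp, mul_ap, h2]; rw [inv_eq_iff, sup_self, g_0i h0 h1]
  refine ⟨sup_a (Or.inl h0), sup_b (Or.inl h1), _, mul_mem (mul_mem ht' he) (inv_mem ht'), ?_⟩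
  exact IsSup.unnest ((f_inj 2).comp (f_inj 0)) (H'.conj h3) (isSup_sup i h ha)

theorem HT.fi {c : Dend N → Dend N} (hc : HT c) {i : L N} (hi : i ≠ 0) : HT (c ∘ f i) := by
  intro h H
  obtain ⟨e, he, H'⟩ := hc _ (Gam_sup hi H)
  exact ⟨e, he, H'.nest (isSup_sup i h H.1)⟩
theorem HT.f0 {c : Dend N → Dend N} (hc : HT c) : IT (c ∘ f 0) := by
  intro h H
  obtain ⟨e, he, H'⟩ := hc _ (Gam_sup0 H)
  exact ⟨e, he, H'.nest (isSup_sup 0 h H.1)⟩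
theorem IT.f0 {c : Dend N → Dend N} (hc : IT c) : IT (c ∘ f 0) := by
  intro h H
  obtain ⟨e, he, H'⟩ := hc _ (Del_sup0 H)
  exact ⟨e, he, H'.nest (isSup_sup 0 h H.1)⟩
theorem IT.f1 {c : Dend N → Dend N} (hc : IT c) : IT (c ∘ f 1) := by
  intro h H
  obtain ⟨e, he, H'⟩ := hc _ (Del_sup1 H)
  exact ⟨e, he, H'.nest (isSup_sup 1 h H.1)⟩
theorem IT.fi {c : Dend N → Dend N} (hc : IT c) {i : L N} (h0 : i ≠ 0) (h1 : i ≠ 1) : HT (c ∘ f i) := by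
  intro h H
  obtain ⟨e, he, H'⟩ := hc _ (Del_supi h0 h1 H)
  exact ⟨e, he, H'.nest (isSup_sup i h H.1)⟩

theorem Gam_trans (w : List (L N)) : ∃ e ∈ Gam N, e (pw w) = p :=
  red_pw Gam_g Gam_s1g w (Or.inl fun _ h => Gam_perm h)

theorem Del_trans (w : List (L N)) (hw : ∀ i ∈ w, i = 0 ∨ i = 1) : ∃ e ∈ Del N, e (pw w) = p :=
  red_pw Del_g (Del_sup1 Del_g) w (Or.inr hw)

theorem E_trans (w : List (L N)) : ∃ e ∈ E N, e (pw w) = p := by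
  have h1 : ∀ (i : L N) (w : List (L N)), ∃ e ∈ E N, e (pw (i :: w)) = f 0 p := by
    intro i w
    obtain ⟨h, H, hp⟩ := Gam_trans w
    refine ⟨perm (Equiv.swap i 0) * sup i h H.1, mul_mem (perm_mem _) (mem_sup i H), ?_⟩
    rw [mul_ap, pw_cons, sup_self, hp, perm_f, Equiv.swap_apply_left]
  have h2 : ∃ e ∈ E N, e (f 0 p) = p := by
    obtain ⟨h, H, hp⟩ := h1 0 [0]
    refine ⟨(h * kap)⁻¹, inv_mem (mul_mem H kap_mem), ?_⟩
    rw [inv_eq_iff, mul_ap, kap_p]; exact hp.symm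
  cases w with
  | nil => exact ⟨1, one_mem _, rfl⟩
  | cons i w =>
    obtain ⟨e, he, h⟩ := h1 i w
    obtain ⟨e', he', h'⟩ := h2
    exact ⟨e' * e, mul_mem he' he, by rw [mul_ap, h, h']⟩

/-! ### Half-trees in open sets -/

/-- Embeddings of half-trees realised by the group. -/
def CC (c : Dend N → Dend N) : Prop := ∃ e ∈ E N, ∀ x, c x = e (f 2 x)

theorem CC_f (i : L N) : CC (f i) :=
  ⟨perm (Equiv.swap 2 i), perm_mem _, fun x => by rw [perm_f, Equiv.swap_apply_left]⟩

theorem CC.f {c : Dend N → Dend N} (hc : CC c) {i : L N} (hi : i ≠ 0) : CC (fun x => c (f i x)) := by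
  obtain ⟨e, he, h⟩ := hc
  obtain ⟨t, ht, h'⟩ := om_mem hi
  exact ⟨e * t, mul_mem he ht, fun x => by rw [mul_ap, h']; exact h _⟩

theorem CC.h {c : Dend N → Dend N} (hc : CC c) {k : Dend N ≃ₜ Dend N} (hk : k ∈ Gam N) :
    CC (fun x => c (k x)) := by
  obtain ⟨e, he, h⟩ := hc
  obtain ⟨-, t, ht, h'⟩ := hk
  exact ⟨e * t, mul_mem he ht, fun x => by rw [mul_ap, h'.1]; exact h _⟩

theorem sg_fw {i : L N} (h0 : i ≠ 0) (h1 : i ≠ 1) (u : List (L N)) (x : Dend N) :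
    sg (fw u (f i x)) = fw (sgw u) (f i x) := by
  cases u with
  | nil => exact sg_i h0 h1 x
  | cons j u => rw [fw_cons, sg, perm_f]; rfl

theorem CC_word (m : ℕ) : ∀ (u : List (L N)), u.length ≤ m → ∀ c, CC c → ∀ i : L N, i ≠ 0 → i ≠ 1 →
    CC (fun x => c (fw u (f i x))) := by
  induction m with
  | zero =>
    intro u hu c hc i h0 h1
    rw [List.length_eq_zero_iff.1 (Nat.le_zero.1 hu)]
    exact hc.f h0
  | succ m ih =>
    intro u hu c hc i h0 h1
    have hg := hc.h (inv_mem Gam_g)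
    cases u with
    | nil => exact hc.f h0
    | cons j u =>
      have hu' : u.length ≤ m := by simpa using hu
      by_cases j0 : j = 0
      · subst j0
        cases u with
        | nil =>
          have := hg.f h0
          simpa only [fw_cons, fw_nil, gi_i h0 h1] using this
        | cons k u =>
          by_cases k0 : k = 0
          · subst k0
            have := ih (0 :: sgw u) (by simpa [sgw_length] using hu') _ (hg.f l10) i h0 h1
            simpa only [fw_cons, gi_10, ← sg_fw h0 h1, sg_sg] using this
          · by_cases k1 : k = 1
            · subst k1
              have := ih (0 :: u) (by simpa using hu') _ hg i h0 h1
              simpa only [fw_cons, gi_0] using this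
            · have := ih (k :: u) hu' _ hg i h0 h1
              simpa only [fw_cons, gi_i k0 k1] using this
      · exact ih u hu' _ (hc.f j0) i h0 h1

theorem open_half {O : Set (Dend N)} (hO : IsOpen O) (hne : O.Nonempty) :
    ∃ e ∈ E N, ∀ x, e (f 2 x) ∈ O := by
  obtain ⟨x, hx⟩ := hne
  obtain ⟨m, hm⟩ := basic_nhd hx hO
  obtain ⟨w, hw, y, hy⟩ := cell_cover m x
  have hs := hm w hw ⟨y, hy.symm⟩
  have : CC (fun x => fw w (f 2 x)) := by
    cases w with
    | nil => exact CC_f 2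
    | cons j w => exact CC_word w.length w le_rfl _ (CC_f j) 2 l20 l21
  obtain ⟨e, he, h⟩ := this
  exact ⟨e, he, fun x => hs ⟨f 2 x, h x⟩⟩

end Waz

open Topology

namespace Waz
open scoped Pointwise
set_option linter.unusedSimpArgs false
set_option linter.unusedSectionVars false

variable {N : ℕ}

instance actD : MulAction (Dend N ≃ₜ Dend N) (Dend N) where
  smul h x := h x
  one_smul _ := rfl
  mul_smul _ _ _ := rfl

theorem smul_D (h : Dend N ≃ₜ Dend N) (x : Dend N) : h • x = h x := rfl
theorem smul_E (e : E N) (x : Dend N) : e • x = (e : Dend N ≃ₜ Dend N) x := rfl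

instance faithE : FaithfulSMul (E N) (Dend N) where
  eq_of_smul_eq_smul {e e'} h := Subtype.ext (homeo_ext h)

/-- The half-trees. -/
def TT (N : ℕ) : Set (Set (Dend N)) := {H | ∃ e : E N, H = e • U 2}

theorem mem_TT_of {c : Dend N → Dend N} (hc : CC c) : c '' {a}ᶜ ∈ TT N := by
  obtain ⟨e, he, h⟩ := hc
  refine ⟨⟨e, he⟩, ?_⟩
  rw [U, ← Set.image_smul, Set.image_image]
  refine Set.image_congr fun x _ => ?_
  rw [h, smul_E]

theorem U_mem_TT (i : L N) : U i ∈ TT N := mem_TT_of (CC_f i)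

theorem kap_U {x : Dend N} (h : x ∉ U 1) : kap x ∈ U 0 := by
  have key : ∀ y : Dend N, y ≠ a → f 0 y ∈ U 0 := fun y hy => f_mem_U.2 ⟨rfl, hy⟩
  obtain ⟨i, x, rfl⟩ := cover x
  by_cases i1 : i = 1
  · subst i1
    have : x = a := by
      by_contra hx; exact h (f_mem_U.2 ⟨rfl, hx⟩)
    rw [this, f_a, kap_p]
    refine key _ ?_
    rw [Ne, f_eq_a]; exact fun h => p_ne_b h.2
  · by_cases i0 : i = 0
    · subst i0
      obtain ⟨j, y, rfl⟩ := cover x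
      by_cases j0 : j = 0
      · subst j0
        rw [kap_00]
        refine key _ ?_
        rw [Ne, f_eq_a]; exact fun h => l01 (f_eq_b.1 h.2).1
      · by_cases j1 : j = 1
        · subst j1
          rw [kap_01]; refine key _ ?_
          rw [Ne, f_eq_a]; exact fun h => l10 h.1
        · rw [kap_0i j0 j1]; refine key _ ?_
          rw [Ne, f_eq_a]; exact fun h => j0 h.1
    · rw [kap_i i0 i1]
      refine key _ ?_
      rw [Ne, f_eq_a]; exact fun h => i1 (f_eq_b.1 h.2).1

theorem perm_U {π : Equiv.Perm (L N)} {i : L N} {x : Dend N} : perm π x ∈ U (π i) ↔ x ∈ U i := by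
  obtain ⟨j, x, rfl⟩ := cover x
  rw [perm_f, f_mem_U, f_mem_U, π.injective.eq_iff]

theorem flipU : ∃ k : E N, ∀ x : Dend N, x ∉ U 2 → k • x ∈ U 2 := by
  refine ⟨⟨perm (Equiv.swap 0 2) * kap * perm (Equiv.swap 2 1),
    mul_mem (mul_mem (perm_mem _) kap_mem) (perm_mem _)⟩, fun x hx => ?_⟩
  rw [smul_E]
  simp only [mul_ap]
  have h1 : perm (Equiv.swap 2 1) x ∉ U 1 := by
    have := (perm_U (π := Equiv.swap 2 1) (i := 2) (x := x)).not.2 hx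
    rwa [Equiv.swap_apply_left] at this
  have := (perm_U (π := Equiv.swap 0 2) (i := 0)).2 (kap_U h1)
  rwa [Equiv.swap_apply_left] at this

/-- Fixing a half-tree, unbundled. -/
def Fx (e : Dend N ≃ₜ Dend N) (V : Set (Dend N)) : Prop := ∀ x ∈ V, e x = x

theorem Fx.mono {e : Dend N ≃ₜ Dend N} {V W : Set (Dend N)} (h : Fx e V) (hW : W ⊆ V) : Fx e W :=
  fun x hx => h x (hW hx)

theorem Fx.inv {e : Dend N ≃ₜ Dend N} {V : Set (Dend N)} (h : Fx e V) : Fx e⁻¹ V := by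
  intro x hx; rw [inv_eq_iff, h x hx]

theorem Fx_perm {π : Equiv.Perm (L N)} {i : L N} (h : π i = i) : Fx (perm π) (U i) := by
  rintro _ ⟨x, -, rfl⟩; rw [perm_f, h]
theorem Fx_sup {i j : L N} (hij : j ≠ i) {h : Dend N ≃ₜ Dend N} {ha : h a = a} : Fx (sup i h ha) (U j) := by
  rintro _ ⟨x, -, rfl⟩; exact sup_ne hij x

def H1 (N : ℕ) : Set (Dend N) := (fun x => f 0 (f 2 x)) '' {a}ᶜ
def H2 (N : ℕ) : Set (Dend N) := (fun x => f 1 (f 2 x)) '' {a}ᶜ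

theorem H1_sub : H1 N ⊆ U 0 := by
  rintro _ ⟨x, hx, rfl⟩
  refine f_mem_U.2 ⟨rfl, ?_⟩
  rw [Ne, f_eq_a]; exact fun h => l20 h.1
theorem H2_sub : H2 N ⊆ U 1 := by
  rintro _ ⟨x, hx, rfl⟩
  refine f_mem_U.2 ⟨rfl, ?_⟩
  rw [Ne, f_eq_a]; exact fun h => l20 h.1
theorem H1_mem : H1 N ∈ TT N := mem_TT_of (CC_word 0 [] le_rfl (f 0) (CC_f 0) 2 l20 l21)
theorem H2_mem : H2 N ∈ TT N := mem_TT_of ((CC_f 1).f l20)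

theorem Fx_kap1 : Fx kap (H1 N) := by
  rintro _ ⟨x, -, rfl⟩; exact kap_0i l20 l21 x
theorem Fx_kap2 : Fx kap (H2 N) := by
  rintro _ ⟨x, -, rfl⟩; exact kap_1i l20 l21 x

/-- The pair condition. -/
def PairOK (e e' : Dend N ≃ₜ Dend N) : Prop := e * e' = e' * e ∨ ∃ H ∈ TT N, Fx e H ∧ Fx e' H

theorem PairOK.symm {e e' : Dend N ≃ₜ Dend N} (h : PairOK e e') : PairOK e' e := by
  rcases h with h | ⟨H, h, h1, h2⟩
  · exact Or.inl h.symm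
  · exact Or.inr ⟨H, h, h2, h1⟩

theorem PairOK.inv {e e' : Dend N ≃ₜ Dend N} (h : PairOK e e') : PairOK e⁻¹ e' := by
  rcases h with h | ⟨H, h, h1, h2⟩
  · exact Or.inl (Commute.inv_left h)
  · exact Or.inr ⟨H, h, h1.inv, h2⟩

theorem exists_out (i j k l : L N) (h : i = k ∨ i = l ∨ j = k ∨ j = l) :
    ∃ m, m ≠ i ∧ m ≠ j ∧ m ≠ k ∧ m ≠ l := by
  classical
  have h3 : ∀ x y z : L N, ∃ m, m ≠ x ∧ m ≠ y ∧ m ≠ z := by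
    intro x y z
    have hc : ({x, y, z} : Finset (L N)).card < (Finset.univ : Finset (L N)).card := by
      refine lt_of_le_of_lt Finset.card_le_three ?_
      simp
    obtain ⟨m, -, hm⟩ := Finset.exists_mem_notMem_of_card_lt_card hc
    simp only [Finset.mem_insert, Finset.mem_singleton, not_or] at hm
    exact ⟨m, hm⟩
  rcases h with h | h | h | h
  · obtain ⟨m, h1, h2, h3⟩ := h3 i j l; exact ⟨m, h1, h2, h ▸ h1, h3⟩
  · obtain ⟨m, h1, h2, h3⟩ := h3 i j k; exact ⟨m, h1, h2, h3, h ▸ h1⟩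
  · obtain ⟨m, h1, h2, h3⟩ := h3 i j l; exact ⟨m, h1, h2, h ▸ h2, h3⟩
  · obtain ⟨m, h1, h2, h3⟩ := h3 i j k; exact ⟨m, h1, h2, h3, h ▸ h2⟩

theorem pair_swap (i j k l : L N) : PairOK (perm (Equiv.swap i j)) (perm (Equiv.swap k l)) := by
  by_cases h : i = k ∨ i = l ∨ j = k ∨ j = l
  · obtain ⟨m, h1, h2, h3, h4⟩ := exists_out i j k l h
    exact Or.inr ⟨U m, U_mem_TT m, Fx_perm (Equiv.swap_apply_of_ne_of_ne h1 h2),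
      Fx_perm (Equiv.swap_apply_of_ne_of_ne h3 h4)⟩
  · push_neg at h
    left
    rw [← perm_mul, ← perm_mul]
    congr 1
    refine Equiv.Perm.Disjoint.commute fun x => ?_
    by_cases hx : x = i ∨ x = j
    · right
      rcases hx with rfl | rfl
      · exact Equiv.swap_apply_of_ne_of_ne h.1 h.2.1
      · exact Equiv.swap_apply_of_ne_of_ne h.2.2.1 h.2.2.2
    · push_neg at hx
      left; exact Equiv.swap_apply_of_ne_of_ne hx.1 hx.2

/-- Shape of generators. -/
theorem gen_cases {e : Dend N ≃ₜ Dend N} (h : IsGen e) :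
    (∃ i j, (Equiv.swap i j 0 = 0 ∨ Equiv.swap i j 1 = 1) ∧ e = perm (Equiv.swap i j)) ∨ e = kap ∨
    ∃ h ha, e = sup 2 h ha := by
  cases h with
  | tr i j h => exact Or.inl ⟨i, j, h, rfl⟩
  | kap => exact Or.inr (Or.inl rfl)
  | sp π h => exact Or.inr (Or.inr ⟨_, _, rfl⟩)
  | sg => exact Or.inr (Or.inr ⟨_, _, rfl⟩)
  | ss => exact Or.inr (Or.inr ⟨_, _, rfl⟩)

theorem gen_fix {e : Dend N ≃ₜ Dend N} (h : IsGen e) : Fx e (H1 N) ∨ Fx e (H2 N) := by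
  rcases gen_cases h with ⟨i, j, hs | hs, rfl⟩ | rfl | ⟨k, hk, rfl⟩
  · exact Or.inl ((Fx_perm hs).mono H1_sub)
  · exact Or.inr ((Fx_perm hs).mono H2_sub)
  · exact Or.inl Fx_kap1
  · exact Or.inl ((Fx_sup l02).mono H1_sub)

theorem gen_pair {e e' : Dend N ≃ₜ Dend N} (h : IsGen e) (h' : IsGen e') : PairOK e e' := by
  have ps : ∀ (i j : L N), (Equiv.swap i j 0 = 0 ∨ Equiv.swap i j 1 = 1) → ∀ k hk,
      PairOK (perm (Equiv.swap i j)) (sup 2 k hk) := by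
    rintro i j (h | h) k hk
    · exact Or.inr ⟨U 0, U_mem_TT 0, Fx_perm h, Fx_sup l02⟩
    · exact Or.inr ⟨U 1, U_mem_TT 1, Fx_perm h, Fx_sup l12⟩
  have pk : ∀ (i j : L N), (Equiv.swap i j 0 = 0 ∨ Equiv.swap i j 1 = 1) →
      PairOK (perm (Equiv.swap i j)) kap := by
    rintro i j (h | h)
    · exact Or.inr ⟨_, H1_mem, (Fx_perm h).mono H1_sub, Fx_kap1⟩
    · exact Or.inr ⟨_, H2_mem, (Fx_perm h).mono H2_sub, Fx_kap2⟩
  have sk : ∀ k hk, PairOK (sup (2 : L N) k hk) kap := by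
    intro k hk
    exact Or.inr ⟨_, H1_mem, (Fx_sup l02).mono H1_sub, Fx_kap1⟩
  rcases gen_cases h with ⟨i, j, hs, rfl⟩ | rfl | ⟨k, hk, rfl⟩ <;>
    rcases gen_cases h' with ⟨i', j', hs', rfl⟩ | rfl | ⟨k', hk', rfl⟩
  · exact pair_swap _ _ _ _
  · exact pk _ _ hs
  · exact ps _ _ hs _ _
  · exact (pk _ _ hs').symm
  · exact Or.inl rfl
  · exact (sk _ _).symm
  · exact (ps _ _ hs' _ _).symm
  · exact sk _ _
  · exact Or.inr ⟨U 0, U_mem_TT 0, Fx_sup l02, Fx_sup l02⟩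

theorem gen_fin : {e : Dend N ≃ₜ Dend N | IsGen e}.Finite := by
  have h1 := Set.finite_range (fun z : L N × L N => perm (Equiv.swap z.1 z.2))
  have h2 := Set.finite_range (fun z : {π : Equiv.Perm (L N) // π 0 = 0} =>
    sup 2 (perm z.1) (perm_a z.2))
  refine ((h1.union h2).union (Set.toFinite {kap, sup 2 g g_a, sup 2 s0g s0g_a})).subset ?_
  intro e he
  cases he with
  | tr i j h => exact Or.inl (Or.inl ⟨(i, j), rfl⟩)
  | kap => exact Or.inr (by simp)
  | sp π h => exact Or.inl (Or.inr ⟨⟨π, h⟩, rfl⟩)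
  | sg => exact Or.inr (by simp)
  | ss => exact Or.inr (by simp)

/-- Symmetric generating set. -/
def BB (N : ℕ) : Set (E N) := {e | IsGen (e : Dend N ≃ₜ Dend N) ∨ IsGen ((e⁻¹ : E N) : Dend N ≃ₜ Dend N)}

theorem BB_fin : (BB N).Finite := by
  have h1 : {e : E N | IsGen (e : Dend N ≃ₜ Dend N)}.Finite :=
    gen_fin.preimage Subtype.val_injective.injOn
  have h2 : {e : E N | IsGen ((e⁻¹ : E N) : Dend N ≃ₜ Dend N)}.Finite :=
    h1.preimage (f := fun e : E N => e⁻¹) inv_injective.injOn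
  exact h1.union h2

theorem BB_gen : Subgroup.closure (BB N) = ⊤ := by
  have h : Subgroup.closure ((↑) ⁻¹' {e : Dend N ≃ₜ Dend N | IsGen e} : Set (E N)) = ⊤ :=
    Subgroup.closure_closure_coe_preimage
  rw [eq_top_iff, ← h]
  exact Subgroup.closure_mono fun e he => Or.inl he

theorem BB_ind {P : (Dend N ≃ₜ Dend N) → Prop} (h : ∀ e, IsGen e → P e) (hi : ∀ e, P e → P e⁻¹)
    {e : E N} (he : e ∈ BB N) : P e := by
  rcases he with he | he
  · exact h _ he
  · have := hi _ (h _ he)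
    simpa only [Subgroup.coe_inv, inv_inv] using this

theorem tree : TreeHyp (TT N) (BB N) (H1 N) (H2 N) where
  inv := by
    rintro e _ ⟨e', rfl⟩
    exact ⟨e * e', by rw [mul_smul]⟩
  ne := by
    rintro _ ⟨e, rfl⟩
    exact (U_ne 2).smul_set
  comp := by
    rintro _ ⟨e, rfl⟩ _ ⟨e', rfl⟩
    obtain ⟨k, hk⟩ := flipU (N := N)
    refine ⟨e' * k * e⁻¹, Subgroup.mem_top _, fun x hx => ?_⟩
    rw [mul_smul, mul_smul, Set.smul_mem_smul_set_iff]
    exact hk _ fun h => hx (Set.mem_smul_set_iff_inv_smul_mem.2 h)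
  split := by
    rintro _ ⟨e, rfl⟩
    have hh : ∀ i : L N, i ≠ 0 → f 2 '' U i ∈ TT N := by
      intro i hi
      have := mem_TT_of ((CC_f 2).f hi)
      rwa [← Set.image_image (f 2) (f i)] at this
    have hsub : ∀ i : L N, i ≠ 0 → f 2 '' U i ⊆ U 2 := by
      rintro i hi _ ⟨_, ⟨y, hy, rfl⟩, rfl⟩
      exact f_mem_U.2 ⟨rfl, fun h => hi (f_eq_a.1 h).1⟩
    have act : ∀ H ∈ TT N, e • H ∈ TT N := by
      rintro _ ⟨e', rfl⟩
      exact ⟨e * e', by rw [mul_smul]⟩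
    refine ⟨_, act _ (hh 1 l10), _, act _ (hh 2 l20), Set.smul_set_mono (hsub 1 l10),
      Set.smul_set_mono (hsub 2 l20), ?_⟩
    refine (Set.disjoint_image_iff (MulAction.injective e)).2 ?_
    exact (Set.disjoint_image_iff (f_inj 2)).2 (U_disj l12)
  move := by
    intro e he
    have : ∃ x, (e : Dend N ≃ₜ Dend N) x ≠ x := by
      by_contra! h
      exact he (Subtype.ext (homeo_ext h))
    obtain ⟨x, hx⟩ := this
    obtain ⟨V, V', hV, hV', m1, m2, hd⟩ := t2_separation hx
    obtain ⟨t, ht, h⟩ := open_half (hV'.inter (hV.preimage (e : Dend N ≃ₜ Dend N).continuous)) ⟨x, m2, m1⟩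
    refine ⟨_, ⟨⟨t, ht⟩, rfl⟩, ?_⟩
    have key : ∀ y ∈ (⟨t, ht⟩ : E N) • U 2, y ∈ V' ∧ (e : Dend N ≃ₜ Dend N) y ∈ V := by
      rintro _ ⟨_, ⟨y, -, rfl⟩, rfl⟩
      exact h y
    intro y hy hy'
    exact Set.disjoint_left.1 hd (key y hy).2 (key _ hy').1
  fin := BB_fin
  binv := by
    rintro e (h | h)
    · exact Or.inr (by rwa [inv_inv])
    · exact Or.inl h
  gen := BB_gen
  mem1 := H1_mem
  mem2 := H2_mem
  disj := (U_disj l01).mono H1_sub H2_sub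
  fix := by
    intro e he
    have := BB_ind (P := fun e => Fx e (H1 N) ∨ Fx e (H2 N)) (fun e => gen_fix)
      (fun e h => h.imp Fx.inv Fx.inv) he
    exact this
  pair := by
    intro e he e' he'
    have h1 : ∀ k, IsGen k → PairOK (e : Dend N ≃ₜ Dend N) k := by
      intro k hk
      exact BB_ind (P := fun e => PairOK e k) (fun e h => gen_pair h hk) (fun e h => h.inv) he
    have h2 : PairOK (e : Dend N ≃ₜ Dend N) e' :=
      BB_ind (P := fun k => PairOK (e : Dend N ≃ₜ Dend N) k) h1 (fun k h => h.symm.inv.symm) he'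
    rcases h2 with h | ⟨H, hH, h3, h4⟩
    · exact Or.inl (Subtype.ext h)
    · exact Or.inr ⟨H, hH, h3, h4⟩

/-- The dense simple subgroup. -/
def SS (N : ℕ) : Subgroup (Dend N ≃ₜ Dend N) := (commutator (E N)).map (E N).subtype

theorem SS_simple : IsSimpleGroup (SS N) := by
  haveI := tree (N := N).simple
  haveI : Nontrivial (SS N) :=
    ((commutator (E N)).equivMapOfInjective _ (E N).subtype_injective).symm.toEquiv.nontrivial
  exact IsSimpleGroup.isSimpleGroup_of_surjective
    ((commutator (E N)).equivMapOfInjective _ (E N).subtype_injective).toMonoidHom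
    ((commutator (E N)).equivMapOfInjective _ (E N).subtype_injective).surjective

theorem SS_fg : (SS N).FG := by
  classical
  obtain ⟨S, hS⟩ := tree (N := N).fg
  refine ⟨S.image (E N).subtype, ?_⟩
  rw [Finset.coe_image, ← MonoidHom.map_closure, hS, SS]

end Waz

open Topology

namespace Waz
open scoped Pointwise
set_option linter.unusedSimpArgs false
set_option linter.unusedSectionVars false

variable {N : ℕ}

/-! ### Density -/

theorem combine (G : Subgroup (Dend N ≃ₜ Dend N)) (h : L N → Dend N ≃ₜ Dend N) (ha : ∀ i, h i a = a)
    (hG : ∀ i, sup i (h i) (ha i) ∈ G) : ∃ e ∈ G, ∀ i x, e (f i x) = f i (h i x) := by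
  classical
  have key : ∀ s : Finset (L N), ∃ e ∈ G, ∀ i x, e (f i x) = if i ∈ s then f i (h i x) else f i x := by
    intro s
    induction s using Finset.induction_on with
    | empty => exact ⟨1, one_mem _, fun i x => by simp [one_ap]⟩
    | insert j s hj ih =>
      obtain ⟨e, he, H⟩ := ih
      refine ⟨sup j (h j) (ha j) * e, mul_mem (hG j) he, fun i x => ?_⟩
      rw [mul_ap, H]
      by_cases hij : i = j
      · subst hij
        rw [if_neg hj, sup_self, if_pos (Finset.mem_insert_self _ _)]
      · by_cases his : i ∈ s
        · rw [if_pos his, sup_ne hij, if_pos (Finset.mem_insert_of_mem his)]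
        · rw [if_neg his, sup_ne hij, if_neg (by simp [hij, his])]
  obtain ⟨e, he, H⟩ := key Finset.univ
  exact ⟨e, he, fun i x => by rw [H, if_pos (Finset.mem_univ i)]⟩

theorem exists_U {x : Dend N} (h : x ≠ p) : ∃ i, x ∈ U i := by
  have : x ∈ ⋃ i, U i := by rw [iUnion_U]; exact h
  exact Set.mem_iUnion.1 this

theorem U_uniq {i j : L N} {x : Dend N} (h : x ∈ U i) (h' : x ∈ U j) : i = j := by
  by_contra hij
  exact Set.disjoint_left.1 (U_disj hij) h h'

theorem map_U {k : Dend N ≃ₜ Dend N} (hk : k p = p) (i : L N) : ∃ j, ∀ x ∈ U i, k x ∈ U j := by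
  obtain ⟨x, hx⟩ := U_ne i
  have hne : ∀ y ∈ U i, k y ≠ p := by
    intro y hy h
    rw [← hk] at h
    exact U_sub i hy (k.injective h)
  obtain ⟨j, hj⟩ := exists_U (hne x hx)
  refine ⟨j, fun y hy => ?_⟩
  exact conn_sub_U ((conn_U i).image k k.continuous.continuousOn)
    (by rintro ⟨y, hy, h⟩; exact hne y hy h) ⟨x, hx, rfl⟩ hj ⟨y, hy, rfl⟩

theorem lift_cont {i : L N} {F G : Dend N → Dend N} (hG : Continuous G) (h : ∀ x, f i (F x) = G x) :
    Continuous F := by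
  rw [((cont_f i).isClosedEmbedding (f_inj i)).isInducing.continuous_iff]
  have : f i ∘ F = G := funext h
  rwa [this]

theorem normal {k : Dend N ≃ₜ Dend N} (hk : k p = p) : ∃ (π : Equiv.Perm (L N))
    (h : L N → Dend N ≃ₜ Dend N), (∀ i, h i a = a) ∧ ∀ i x, k (f i x) = f (π i) (h i x) := by
  have hk' : k⁻¹ p = p := inv_eq_iff.2 hk.symm
  choose σ hσ using map_U hk
  choose τ hτ using map_U hk'
  have l : ∀ i, τ (σ i) = i := by
    intro i
    obtain ⟨x, hx⟩ := U_ne i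
    have := hτ _ _ (hσ i x hx)
    rw [inv_ap] at this
    exact U_uniq this hx
  have r : ∀ i, σ (τ i) = i := by
    intro i
    obtain ⟨x, hx⟩ := U_ne i
    have := hσ _ _ (hτ i x hx)
    rw [ap_inv] at this
    exact U_uniq this hx
  have h1 : ∀ i x, ∃ y, f (σ i) y = k (f i x) := by
    intro i x
    by_cases hx : x = a
    · exact ⟨a, by rw [hx, f_a, f_a, hk]⟩
    · obtain ⟨y, -, hy⟩ := hσ i _ (f_mem_U.2 ⟨rfl, hx⟩)
      exact ⟨y, hy⟩
  have h2 : ∀ i x, ∃ y, f i y = k⁻¹ (f (σ i) x) := by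
    intro i x
    by_cases hx : x = a
    · exact ⟨a, by rw [hx, f_a, f_a, hk']⟩
    · obtain ⟨y, -, hy⟩ := hτ (σ i) _ (f_mem_U.2 ⟨rfl, hx⟩)
      rw [l] at hy
      exact ⟨y, hy⟩
  choose F hF using h1
  choose G hG using h2
  refine ⟨⟨σ, τ, l, r⟩, fun i => ⟨⟨F i, G i, fun x => ?_, fun x => ?_⟩,
    lift_cont (k.continuous.comp (cont_f i)) (hF i),
    lift_cont ((k⁻¹).continuous.comp (cont_f (σ i))) (hG i)⟩, fun i => ?_, fun i x => (hF i x).symm⟩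
  · apply f_inj i
    rw [hG, hF, inv_ap]
  · apply f_inj (σ i)
    rw [hF, hG, ap_inv]
  · apply f_inj (σ i)
    exact (hF i a).trans (by rw [f_a, f_a, hk])

/-- Approximation on cells of level `m`. -/
def Appr (m : ℕ) (e k : Dend N ≃ₜ Dend N) : Prop :=
  ∀ v : List (L N), v.length = m → ∀ x, ∃ y, e (k (fw v x)) = fw v y

theorem Appr.step {m : ℕ} (G : Subgroup (Dend N ≃ₜ Dend N)) {k γ : Dend N ≃ₜ Dend N} (hγ : γ ∈ G)
    {π : Equiv.Perm (L N)} (hπ : perm π ∈ G) {h : L N → Dend N ≃ₜ Dend N}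
    (hk : ∀ i x, γ (k (f i x)) = f (π i) (h i x))
    (H : ∀ i, ∃ t, ∃ ta : t a = a, sup i t ta ∈ G ∧ Appr m t (h i)) :
    ∃ e ∈ G, Appr (m + 1) e k := by
  choose t ta tG tA using H
  obtain ⟨e, he, H⟩ := combine G t ta tG
  refine ⟨e * perm π⁻¹ * γ, mul_mem (mul_mem he (by rw [perm_inv]; exact inv_mem hπ)) hγ, ?_⟩
  intro v hv x
  cases v with
  | nil => simp at hv
  | cons i v =>
    obtain ⟨y, hy⟩ := tA i v (by simpa using hv) x
    refine ⟨y, ?_⟩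
    rw [fw_cons, mul_ap, mul_ap, hk, perm_f, show (π⁻¹ : Equiv.Perm (L N)) (π i) = i from π.symm_apply_apply i, H, hy, fw_cons]

theorem bin_of {v : List (L N)} (hv : ¬ ∀ i ∈ v, i = 0 ∨ i = 1) :
    ∃ S : Set (Dend N), IsPreconnected S ∧ a ∈ S ∧ b ∈ S ∧ pw v ∉ S := by
  induction v with
  | nil => exact absurd (by simp) hv
  | cons i w ih =>
    have hnot : ∀ j y, j ≠ i → f j y ≠ pw (i :: w) := by
      intro j y hj h
      rw [pw_cons, f_eq_ne hj] at h
      exact pw_ne_a w h.2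
    by_cases h01 : i = 0 ∨ i = 1
    · have hw : ¬ ∀ i ∈ w, i = 0 ∨ i = 1 := by
        intro h
        apply hv
        intro j hj
        rcases List.mem_cons.1 hj with rfl | hj
        · exact h01
        · exact h j hj
      obtain ⟨S, hS, ha, hb, hp⟩ := ih hw
      refine ⟨f i '' S ∪ cells (fun j => j ≠ i), ?_, ?_, ?_, ?_⟩
      · have hne : ∃ j : L N, j ≠ i := by
          rcases h01 with rfl | rfl
          · exact ⟨1, l10⟩
          · exact ⟨0, l01⟩
        obtain ⟨j, hj⟩ := hne
        exact IsPreconnected.union p ⟨a, ha, f_a i⟩ ⟨j, a, hj, f_a j⟩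
          (hS.image _ (cont_f i).continuousOn) (conn_cells _)
      · by_cases h : i = 0
        · subst h; exact Or.inl ⟨b, hb, f_0_b⟩
        · exact Or.inr ⟨0, b, fun h' => h h'.symm, f_0_b⟩
      · by_cases h : i = 1
        · subst h; exact Or.inl ⟨b, hb, f_1_b⟩
        · exact Or.inr ⟨1, b, fun h' => h h'.symm, f_1_b⟩
      · rintro (⟨y, hy, h⟩ | ⟨j, y, hj, h⟩)
        · rw [pw_cons, f_inj_iff] at h
          exact hp (h ▸ hy)
        · exact hnot j y hj h
    · push_neg at h01
      refine ⟨cells (fun j => j ≠ i), conn_cells _, ⟨0, b, h01.1.symm, f_0_b⟩, ⟨1, b, h01.2.symm, f_1_b⟩, ?_⟩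
      rintro ⟨j, y, hj, h⟩
      exact hnot j y hj h

theorem a_mem_U : (a : Dend N) ∈ U 0 := by
  have := (f_mem_U (i := (0 : L N)) (j := 0)).2 ⟨rfl, b_ne_a⟩
  rwa [f_0_b] at this
theorem b_mem_U : (b : Dend N) ∈ U 1 := by
  have := (f_mem_U (i := (1 : L N)) (j := 1)).2 ⟨rfl, b_ne_a⟩
  rwa [f_1_b] at this

theorem bin_homeo {k : Dend N ≃ₜ Dend N} (ha : k a = a) (hb : k b = b) {v : List (L N)}
    (hv : k p = pw v) : ∀ i ∈ v, i = 0 ∨ i = 1 := by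
  by_contra hc
  obtain ⟨S, hS, h1, h2, h3⟩ := bin_of hc
  have ha' : k⁻¹ a = a := inv_eq_iff.2 ha.symm
  have hb' : k⁻¹ b = b := inv_eq_iff.2 hb.symm
  have := conn_sub_U (hS.image (k⁻¹ : Dend N ≃ₜ Dend N) (k⁻¹ : Dend N ≃ₜ Dend N).continuous.continuousOn)
    (by
      rintro ⟨y, hy, h⟩
      rw [inv_eq_iff, hv] at h
      exact h3 (h ▸ hy)) ⟨a, h1, ha'⟩ a_mem_U ⟨b, h2, hb'⟩
  exact l01 (U_uniq this b_mem_U)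

theorem norm_a {k : Dend N ≃ₜ Dend N} (ha : k a = a) {π : Equiv.Perm (L N)}
    {h : L N → Dend N ≃ₜ Dend N} (hk : ∀ i x, k (f i x) = f (π i) (h i x)) :
    π 0 = 0 ∧ h 0 b = b := by
  have := hk 0 b
  rw [f_0_b, ha] at this
  exact f_eq_a.1 this.symm

theorem norm_b {k : Dend N ≃ₜ Dend N} (hb : k b = b) {π : Equiv.Perm (L N)}
    {h : L N → Dend N ≃ₜ Dend N} (hk : ∀ i x, k (f i x) = f (π i) (h i x)) :
    π 1 = 1 ∧ h 1 b = b := by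
  have := hk 1 b
  rw [f_1_b, hb] at this
  exact f_eq_b.1 this.symm

theorem GD_appr (m : ℕ) : (∀ k : Dend N ≃ₜ Dend N, k a = a → ∃ e ∈ Gam N, Appr m e k) ∧
    (∀ k : Dend N ≃ₜ Dend N, k a = a → k b = b → ∃ e ∈ Del N, Appr m e k) := by
  induction m with
  | zero =>
    have h0 : ∀ k : Dend N ≃ₜ Dend N, Appr 0 1 k := by
      intro k v hv x
      rw [List.length_eq_zero_iff.1 hv]
      exact ⟨k x, rfl⟩
    exact ⟨fun k _ => ⟨1, one_mem _, h0 k⟩, fun k _ _ => ⟨1, one_mem _, h0 k⟩⟩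
  | succ m ih =>
    obtain ⟨ihG, ihD⟩ := ih
    constructor
    · intro k ka
      obtain ⟨v, hv⟩ := branch_homeo k
      obtain ⟨γ, hγ, hp⟩ := Gam_trans v
      rw [← hv] at hp
      obtain ⟨π, h, ha, hk⟩ := normal (k := γ * k) hp
      obtain ⟨π0, h0⟩ := norm_a (by rw [mul_ap, ka, Gam_a hγ]) hk
      refine Appr.step (Gam N) hγ (Gam_perm π0) hk fun i => ?_
      by_cases i0 : i = 0
      · subst i0
        obtain ⟨t, ht, hA⟩ := ihD (h 0) (ha 0) h0
        exact ⟨t, Del_a ht, Gam_sup0 ht, hA⟩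
      · obtain ⟨t, ht, hA⟩ := ihG (h i) (ha i)
        exact ⟨t, Gam_a ht, Gam_sup i0 ht, hA⟩
    · intro k ka kb
      obtain ⟨v, hv⟩ := branch_homeo k
      obtain ⟨γ, hγ, hp⟩ := Del_trans v (bin_homeo ka kb hv)
      rw [← hv] at hp
      obtain ⟨π, h, ha, hk⟩ := normal (k := γ * k) hp
      obtain ⟨π0, h0⟩ := norm_a (by rw [mul_ap, ka, Del_a hγ]) hk
      obtain ⟨π1, h1⟩ := norm_b (by rw [mul_ap, kb, Del_b hγ]) hk
      refine Appr.step (Del N) hγ (Del_perm π0 π1) hk fun i => ?_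
      by_cases i0 : i = 0
      · subst i0
        obtain ⟨t, ht, hA⟩ := ihD (h 0) (ha 0) h0
        exact ⟨t, Del_a ht, Del_sup0 ht, hA⟩
      · by_cases i1 : i = 1
        · subst i1
          obtain ⟨t, ht, hA⟩ := ihD (h 1) (ha 1) h1
          exact ⟨t, Del_a ht, Del_sup1 ht, hA⟩
        · obtain ⟨t, ht, hA⟩ := ihG (h i) (ha i)
          exact ⟨t, Gam_a ht, Del_supi i0 i1 ht, hA⟩

theorem E_appr (m : ℕ) (k : Dend N ≃ₜ Dend N) : ∃ e ∈ E N, Appr (m + 1) e k := by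
  obtain ⟨v, hv⟩ := branch_homeo k
  obtain ⟨γ, hγ, hp⟩ := E_trans v
  rw [← hv] at hp
  obtain ⟨π, h, ha, hk⟩ := normal (k := γ * k) hp
  refine Appr.step (E N) hγ (perm_mem π) hk fun i => ?_
  obtain ⟨t, ht, hA⟩ := (GD_appr m).1 (h i) (ha i)
  exact ⟨t, Gam_a ht, mem_sup i ht, hA⟩

theorem tendsto_homeo {u : ℕ → Dend N ≃ₜ Dend N} {k : Dend N ≃ₜ Dend N}
    (h : ∀ C : Set (Dend N), IsCompact C → ∀ O : Set (Dend N), IsOpen O → (∀ x ∈ C, k x ∈ O) →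
      ∀ᶠ m in Filter.atTop, ∀ x ∈ C, u m x ∈ O) : Filter.Tendsto u Filter.atTop (𝓝 k) := by
  rw [nhds_induced, Filter.tendsto_comap_iff, ContinuousMap.tendsto_nhds_compactOpen]
  exact h

theorem E_dense (k : Dend N ≃ₜ Dend N) : k ∈ closure (E N : Set (Dend N ≃ₜ Dend N)) := by
  choose e he hA using fun m => E_appr m k
  refine mem_closure_of_tendsto (f := fun m => (e m)⁻¹) (b := Filter.atTop) ?_
    (Filter.Eventually.of_forall fun m => inv_mem (he m))
  refine tendsto_homeo fun C hC O hO hCO => ?_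
  have hW : IsOpen (Cᶜ ×ˢ (Set.univ : Set (Dend N)) ∪ Set.univ ×ˢ (k ⁻¹' O)) :=
    (hC.isClosed.isOpen_compl.prod isOpen_univ).union (isOpen_univ.prod (hO.preimage k.continuous))
  obtain ⟨m, hm⟩ := shrink hW (by
    intro x
    by_cases hx : x ∈ C
    · exact Or.inr ⟨trivial, hCO x hx⟩
    · exact Or.inl ⟨hx, trivial⟩)
  filter_upwards [Filter.eventually_ge_atTop m] with j hj x hx
  obtain ⟨z, hz⟩ : ∃ z, (e j) (k z) = x := ⟨k⁻¹ ((e j)⁻¹ x), by rw [ap_inv, ap_inv]⟩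
  have hz' : (e j)⁻¹ x = k z := inv_eq_iff.2 hz.symm
  show (e j)⁻¹ x ∈ O
  rw [hz']
  obtain ⟨v, hv, z', rfl⟩ := cell_cover (j + 1) z
  obtain ⟨y, hy⟩ := hA j v hv z'
  rw [hz] at hy
  have hsplit : ∀ t, fw v t = fw (v.take m) (fw (v.drop m) t) := by
    intro t; rw [← fw_append, List.take_append_drop]
  have := hm (v.take m) (by rw [List.length_take]; omega) (fw (v.drop m) y) (fw (v.drop m) z')
  rw [← hsplit, ← hsplit, ← hy] at this
  rcases this with ⟨h, -⟩ | ⟨-, h⟩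
  · exact absurd hx h
  · exact h

theorem SS_close {e : Dend N ≃ₜ Dend N} (he : e ∈ E N) : e ∈ closure (SS N : Set (Dend N ≃ₜ Dend N)) := by
  haveI := metr (N := N)
  obtain ⟨V, hV⟩ := (𝓝 (p : Dend N)).exists_antitone_basis
  have hH : ∀ m, ∃ H ∈ TT N, H ⊆ V m := by
    intro m
    obtain ⟨t, ht, h⟩ := open_half (isOpen_interior (s := V m))
      ⟨p, mem_interior_iff_mem_nhds.2 (hV.1.mem_of_mem trivial)⟩
    refine ⟨_, ⟨⟨t, ht⟩, rfl⟩, ?_⟩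
    rintro _ ⟨_, ⟨y, -, rfl⟩, rfl⟩
    exact interior_subset (h y)
  choose H hT hHV using hH
  choose s hs hse using fun m => tree.agree (⟨e, he⟩ : E N) (H m) (hT m)
  refine mem_closure_of_tendsto (f := fun m => ((s m : E N) : Dend N ≃ₜ Dend N)) (b := Filter.atTop) ?_
    (Filter.Eventually.of_forall fun m => ⟨s m, hs m, rfl⟩)
  refine tendsto_homeo fun C hC O hO hCO => ?_
  by_cases hp : p ∈ C
  · obtain ⟨m, hm⟩ := hV.mem_iff.1 ((hO.preimage e.continuous).mem_nhds (hCO p hp))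
    filter_upwards [Filter.eventually_ge_atTop m] with j hj x hx
    by_cases hxH : x ∈ H j
    · obtain ⟨y, hy⟩ : ∃ y, e y = (s j : Dend N ≃ₜ Dend N) x := ⟨e⁻¹ _, ap_inv _ _⟩
      have hyH : y ∈ H j := by
        by_contra hyH
        have h1 : (s j : Dend N ≃ₜ Dend N) y = e y := hse j y hyH
        rw [hy] at h1
        exact hyH ((s j : Dend N ≃ₜ Dend N).injective h1 ▸ hxH)
      rw [← hy]
      exact hm (hV.2 hj (hHV j hyH))
    · have h1 : (s j : Dend N ≃ₜ Dend N) x = e x := hse j x hxH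
      rw [h1]; exact hCO x hx
  · obtain ⟨m, hm⟩ := hV.mem_iff.1 (hC.isClosed.isOpen_compl.mem_nhds hp)
    filter_upwards [Filter.eventually_ge_atTop m] with j hj x hx
    have h1 : (s j : Dend N ≃ₜ Dend N) x = e x := hse j x fun h => hm (hV.2 hj (hHV j h)) hx
    rw [h1]; exact hCO x hx

theorem SS_dense : Dense (SS N : Set (Dend N ≃ₜ Dend N)) := by
  intro k
  have : closure (E N : Set (Dend N ≃ₜ Dend N)) ⊆ closure (SS N : Set (Dend N ≃ₜ Dend N)) :=
    closure_minimal (fun e he => SS_close he) isClosed_closure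
  exact this (E_dense k)

end Waz

theorem statement6 (n : ℕ) (hn : 4 ≤ n) :
    ∃ (X : Type) (_ : TopologicalSpace X) (_ : IsWazewskiDendrite n X)
      (S : Subgroup (X ≃ₜ X)),
      IsSimpleGroup S ∧ S.FG ∧ Dense (S : Set (X ≃ₜ X)) := by
  obtain ⟨N, rfl⟩ := Nat.exists_eq_add_of_le' hn
  exact ⟨Waz.Dend N, inferInstance, Waz.wazewski, Waz.SS N, Waz.SS_simple, Waz.SS_fg, Waz.SS_dense⟩
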